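/- Let 0 < ε < 1 and let 𝒮 be a martingale ε-sparse family of subintervals of [0,1). There exists a constant C(p) > 0, depending only on p and independent of k, ε, 𝒮, and the choices of the intervals I(J), such that for every subinterval L of [0,1): Σ_{I ∈ 𝒮, I ⊆ L} ⟨w_k⟩_I^p·⟨σ_k⟩_I·|I| ≤ C(p)·k·w_k(L)/(1−ε) and Σ_{I ∈ 𝒮, I ⊆ L} ⟨σ_k⟩_I^{p'}·⟨w_k⟩_I·|I| ≤ C(p)·k·σ_k(L)/(1−ε), where p' := p/(p−1). -/

import Mathlib

open MeasureTheory Set Filter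

noncomputable section

namespace RTpaper

/-- The half-open interval `[a, b)` represented by the pair `(a, b)`. -/
def ivSet (I : ℝ × ℝ) : Set ℝ := Set.Ico I.1 I.2

/-- The length of the interval represented by `I`. -/
def len (I : ℝ × ℝ) : ℝ := I.2 - I.1

/-- The middle triadic child of an interval. -/
def mid (I : ℝ × ℝ) : ℝ × ℝ := (I.1 + (I.2 - I.1) / 3, I.2 - (I.2 - I.1) / 3)

/-- The families `𝐊ᵢ` of the Reguera–Thiele construction. -/
def Kfam (k : ℕ) : ℕ → Set (ℝ × ℝ)
  | 0 => {((0 : ℝ), (1 : ℝ))}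
  | (i + 1) =>
      {I | ∃ K ∈ Kfam k i, ∃ j : ℕ, j < 3 ^ (k - 1) ∧
        I = ((mid K).1 + (j : ℝ) * ((3 : ℝ) ^ (1 - (k : ℤ)) * len (mid K)),
             (mid K).1 + ((j : ℝ) + 1) * ((3 : ℝ) ^ (1 - (k : ℤ)) * len (mid K)))}

/-- The families `𝐉ᵢ` (of interest for `i ≥ 1`). -/
def Jfam (k i : ℕ) : Set (ℝ × ℝ) := {J | ∃ K ∈ Kfam k (i - 1), J = mid K}

/-- The family `𝐊 = ⋃ᵢ 𝐊ᵢ`. -/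
def KK (k : ℕ) : Set (ℝ × ℝ) := ⋃ i, Kfam k i

/-- The family `𝐉 = ⋃_{i ≥ 1} 𝐉ᵢ`. -/
def JJ (k : ℕ) : Set (ℝ × ℝ) := ⋃ i, Jfam k (i + 1)

/-- The chosen triadic interval `I(J)` adjacent to `J` of length `3^{1-k}|J|`, encoded by a
choice function `ch` deciding, for each `J`, whether `I(J)` lies to the right (`true`) or to
the left (`false`) of `J`. -/
def IJ (k : ℕ) (ch : ℝ × ℝ → Bool) (J : ℝ × ℝ) : ℝ × ℝ :=
  if ch J then (J.2, J.2 + (3 : ℝ) ^ (1 - (k : ℤ)) * len J)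
  else (J.1 - (3 : ℝ) ^ (1 - (k : ℤ)) * len J, J.1)

/-- The weight `w_k = Σ_{i ≥ 1} Σ_{J ∈ 𝐉ᵢ} (3^k/(3^{k-1}+1))^i · 1_{I(J)}`. -/
def wgt (k : ℕ) (ch : ℝ × ℝ → Bool) (x : ℝ) : ℝ :=
  ∑' i : ℕ, ∑' J : ↥(Jfam k (i + 1)),
    Set.indicator (ivSet (IJ k ch (J : ℝ × ℝ)))
      (fun _ => ((3 : ℝ) ^ k / ((3 : ℝ) ^ (k - 1) + 1)) ^ (i + 1)) x

/-- The weight `σ_k = w_k^{1-p}` on `{w_k > 0}`, and `0` elsewhere. -/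
def sgm (p : ℝ) (k : ℕ) (ch : ℝ × ℝ → Bool) (x : ℝ) : ℝ :=
  if 0 < wgt k ch x then wgt k ch x ^ (1 - p) else 0

/-- `u(I) = ∫_I u`. -/
def mass (u : ℝ → ℝ) (I : ℝ × ℝ) : ℝ := ∫ x in ivSet I, u x

/-- `⟨u⟩_I = u(I)/|I|`. -/
def avg (u : ℝ → ℝ) (I : ℝ × ℝ) : ℝ := mass u I / len I

/-- `ch_𝐊(K)`: the members of `𝐊_{i+1}` contained in `K ∈ 𝐊ᵢ`. -/
def chK (k : ℕ) (K : ℝ × ℝ) : Set (ℝ × ℝ) :=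
  {K' | ∃ i, K ∈ Kfam k i ∧ K' ∈ Kfam k (i + 1) ∧ ivSet K' ⊆ ivSet K}

/-- Triadic intervals of `ℝ`. -/
def IsTriadic (I : ℝ × ℝ) : Prop :=
  ∃ n j : ℤ, I.1 = (j : ℝ) * (3 : ℝ) ^ (-n) ∧ I.2 = ((j : ℝ) + 1) * (3 : ℝ) ^ (-n)

/-- Maximal members of `S` strictly contained in `R`. -/
def maxIn (S : Set (ℝ × ℝ)) (R : ℝ × ℝ) : Set (ℝ × ℝ) :=
  {Q | Q ∈ S ∧ ivSet Q ⊂ ivSet R ∧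
    ∀ Q' ∈ S, ivSet Q ⊆ ivSet Q' → ivSet Q' ⊂ ivSet R → ivSet Q' = ivSet Q}

/-- Martingale `ε`-sparse families of (half-open) intervals. -/
def MSparse (ε : ℝ) (S : Set (ℝ × ℝ)) : Prop :=
  S.Countable ∧ (∀ I ∈ S, I.1 < I.2) ∧
    (∀ I ∈ S, ∀ J ∈ S, ivSet I ⊆ ivSet J ∨ ivSet J ⊆ ivSet I ∨ ivSet I ∩ ivSet J = ∅) ∧
    ∀ R ∈ S, (∑' Q : ↥(maxIn S R), len (Q : ℝ × ℝ)) ≤ ε * len R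

/-- `Σ_{I ∈ F} ⟨u⟩_I^q · ⟨v⟩_I · |I|`. -/
def sumTest (q : ℝ) (u v : ℝ → ℝ) (F : Set (ℝ × ℝ)) : ℝ :=
  ∑' I : ↥F, avg u (I : ℝ × ℝ) ^ q * avg v (I : ℝ × ℝ) * len (I : ℝ × ℝ)


/-! ### Structure of the construction -/

def dl (k i : ℕ) : ℝ := ((3 : ℝ) ^ (k * i))⁻¹

def cell (k i m : ℕ) : ℝ × ℝ := ((m : ℝ) * dl k i, ((m : ℝ) + 1) * dl k i)

def MM (k : ℕ) : ℕ → Set ℕ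
  | 0 => {0}
  | (i + 1) => {n | ∃ m ∈ MM k i, ∃ j : ℕ, j < 3 ^ (k - 1) ∧ n = m * 3 ^ k + 3 ^ (k - 1) + j}

def cI (k : ℕ) (ch : ℝ × ℝ → Bool) (i m : ℕ) : ℕ :=
  if ch (mid (cell k i m)) then m * 3 ^ k + 2 * 3 ^ (k - 1) else m * 3 ^ k + 3 ^ (k - 1) - 1

def UU (k : ℕ) (ch : ℝ × ℝ → Bool) (i : ℕ) : Set ℝ :=
  ⋃ m ∈ MM k i, ivSet (cell k (i + 1) (cI k ch i m))

def BB (k i : ℕ) : Set ℝ := ⋃ m ∈ MM k i, ivSet (cell k i m)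

def aa (k : ℕ) : ℝ := (3 : ℝ) ^ k / ((3 : ℝ) ^ (k - 1) + 1)

lemma dl_pos (k i : ℕ) : 0 < dl k i := by unfold dl; positivity

lemma dl_succ (k i : ℕ) : (3 : ℝ) ^ k * dl k (i + 1) = dl k i := by
  unfold dl
  rw [Nat.mul_succ, pow_add]
  field_simp

lemma dl_zero (k : ℕ) : dl k 0 = 1 := by simp [dl]

lemma pow_k {k : ℕ} (hk : 3000 < k) : 3 ^ k = 3 * 3 ^ (k - 1) := by
  obtain ⟨l, rfl⟩ : ∃ l, k = l + 1 := ⟨k - 1, by omega⟩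
  simp [pow_succ, mul_comm]

lemma pow_kR {k : ℕ} (hk : 3000 < k) : (3 : ℝ) ^ k = 3 * 3 ^ (k - 1) := by
  exact_mod_cast pow_k hk

lemma pow_k1 {k : ℕ} (hk : 3000 < k) : 27 ≤ 3 ^ (k - 1) := by
  calc 27 = 3 ^ 3 := by norm_num
    _ ≤ 3 ^ (k - 1) := Nat.pow_le_pow_right (by norm_num) (by omega)

lemma pow_k1R {k : ℕ} (hk : 3000 < k) : (27 : ℝ) ≤ 3 ^ (k - 1) := by
  exact_mod_cast pow_k1 hk

lemma dl_anti (k : ℕ) {i j : ℕ} (h : i ≤ j) : dl k j ≤ dl k i := by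
  unfold dl
  apply inv_anti₀ (by positivity)
  exact pow_le_pow_right₀ (by norm_num) (Nat.mul_le_mul_left _ h)

lemma mem_cell {k i m : ℕ} {x : ℝ} :
    x ∈ ivSet (cell k i m) ↔ (m : ℝ) * dl k i ≤ x ∧ x < ((m : ℝ) + 1) * dl k i := Iff.rfl

lemma cell_unique {k i m m' : ℕ} {x : ℝ} (h : x ∈ ivSet (cell k i m))
    (h' : x ∈ ivSet (cell k i m')) : m = m' := by
  rw [mem_cell] at h h'
  have h1 : (m : ℝ) < m' + 1 := lt_of_mul_lt_mul_right (h.1.trans_lt h'.2) (dl_pos k i).le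
  have h2 : (m' : ℝ) < m + 1 := lt_of_mul_lt_mul_right (h'.1.trans_lt h.2) (dl_pos k i).le
  norm_cast at h1 h2
  omega

lemma cell_parent {k i q r : ℕ} {x : ℝ} (h : x ∈ ivSet (cell k (i + 1) (q * 3 ^ k + r)))
    (hr : r < 3 ^ k) : x ∈ ivSet (cell k i q) := by
  rw [mem_cell] at h ⊢
  have h0 := dl_succ k i
  have hp := dl_pos k (i + 1)
  push_cast at h
  have hr' : (r : ℝ) + 1 ≤ 3 ^ k := by exact_mod_cast hr
  rw [← h0]
  constructor
  · refine le_trans ?_ h.1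
    have : (0 : ℝ) ≤ r * dl k (i + 1) := by positivity
    nlinarith
  · refine lt_of_lt_of_le h.2 ?_
    nlinarith [mul_le_mul_of_nonneg_right hr' hp.le]

/-- centred: the child position is at least about a third away from the boundary -/
lemma cell_parent_far {k : ℕ} (hk : 3000 < k) {i q r : ℕ} {x y : ℝ}
    (h : x ∈ ivSet (cell k (i + 1) (q * 3 ^ k + r)))
    (hr : 3 ^ (k - 1) - 1 ≤ r) (hr2 : r ≤ 2 * 3 ^ (k - 1)) (hy : |y - x| < dl k i / 4) :
    y ∈ ivSet (cell k i q) := by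
  rw [mem_cell] at h ⊢
  have h0 := dl_succ k i
  have hp := dl_pos k (i + 1)
  have h27 := pow_k1 hk
  have h27' := pow_k1R hk
  rw [pow_kR hk] at h0
  push_cast at h
  rw [pow_kR hk] at h
  have hr' : (3 : ℝ) ^ (k - 1) ≤ r + 1 := by
    have : 3 ^ (k - 1) ≤ r + 1 := by omega
    exact_mod_cast this
  have hr2' : (r : ℝ) ≤ 2 * 3 ^ (k - 1) := by exact_mod_cast hr2
  rw [← h0] at hy ⊢
  set T := (3 : ℝ) ^ (k - 1)
  set d := dl k (i + 1)
  rw [abs_lt] at hy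
  have e1 : T * d ≤ (r + 1) * d := by gcongr
  have e2 : r * d ≤ 2 * T * d := by gcongr
  have e3 : 27 * d ≤ T * d := by gcongr
  constructor <;> nlinarith

lemma MM_succ_parent {k : ℕ} {i n : ℕ} (h : n ∈ MM k (i + 1)) :
    ∃ m ∈ MM k i, ∃ r, n = m * 3 ^ k + r ∧ 3 ^ (k - 1) ≤ r ∧ r < 2 * 3 ^ (k - 1) := by
  obtain ⟨m, hm, j, hj, rfl⟩ := h
  exact ⟨m, hm, 3 ^ (k - 1) + j, by ring, by omega, by omega⟩

lemma cI_form {k : ℕ} (hk : 3000 < k) (ch : ℝ × ℝ → Bool) (i m : ℕ) :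
    ∃ r, cI k ch i m = m * 3 ^ k + r ∧ (r = 3 ^ (k - 1) - 1 ∨ r = 2 * 3 ^ (k - 1)) := by
  have := pow_k1 hk
  unfold cI
  split_ifs
  · exact ⟨_, rfl, Or.inr rfl⟩
  · exact ⟨3 ^ (k - 1) - 1, by omega, Or.inl rfl⟩

lemma mem_UU {k : ℕ} {ch : ℝ × ℝ → Bool} {i : ℕ} {x : ℝ} :
    x ∈ UU k ch i ↔ ∃ m ∈ MM k i, x ∈ ivSet (cell k (i + 1) (cI k ch i m)) := by
  simp [UU]

lemma mem_BB {k i : ℕ} {x : ℝ} : x ∈ BB k i ↔ ∃ m ∈ MM k i, x ∈ ivSet (cell k i m) := by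
  simp [BB]

lemma UU_cell {k : ℕ} (hk : 3000 < k) {ch : ℝ × ℝ → Bool} {i m : ℕ} {x : ℝ}
    (h : x ∈ ivSet (cell k (i + 1) (cI k ch i m))) : x ∈ ivSet (cell k i m) := by
  obtain ⟨r, hr, hr'⟩ := cI_form hk ch i m
  rw [hr] at h
  have := pow_k hk
  have := pow_k1 hk
  exact cell_parent h (by omega)

lemma UU_sub_BB {k : ℕ} (hk : 3000 < k) {ch : ℝ × ℝ → Bool} {i : ℕ} {x : ℝ}
    (h : x ∈ UU k ch i) : x ∈ BB k i := by
  obtain ⟨m, hm, hx⟩ := mem_UU.1 h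
  exact mem_BB.2 ⟨m, hm, UU_cell hk hx⟩

lemma BB_anti_succ {k : ℕ} (hk : 3000 < k) {i : ℕ} {x : ℝ}
    (h : x ∈ BB k (i + 1)) : x ∈ BB k i := by
  obtain ⟨n, hn, hx⟩ := mem_BB.1 h
  obtain ⟨m, hm, r, rfl, h1, h2⟩ := MM_succ_parent hn
  have := pow_k hk
  have := pow_k1 hk
  exact mem_BB.2 ⟨m, hm, cell_parent hx (by omega)⟩

lemma BB_anti {k : ℕ} (hk : 3000 < k) {i j : ℕ} (hij : i ≤ j) {x : ℝ}
    (h : x ∈ BB k j) : x ∈ BB k i := by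
  induction j, hij using Nat.le_induction with
  | base => exact h
  | succ j _ ih => exact ih (BB_anti_succ hk h)

lemma divmod_unique {N q q' r r' : ℕ} (hr : r < N) (hr' : r' < N)
    (h : q * N + r = q' * N + r') : q = q' ∧ r = r' := by
  have h1 : (q * N + r) / N = q := by
    rw [mul_comm, Nat.mul_add_div (by omega), Nat.div_eq_of_lt hr, add_zero]
  have h2 : (q' * N + r') / N = q' := by
    rw [mul_comm, Nat.mul_add_div (by omega), Nat.div_eq_of_lt hr', add_zero]
  have : q = q' := by rw [← h1, ← h2, h]
  subst this
  exact ⟨rfl, by omega⟩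

lemma UU_not_BB {k : ℕ} (hk : 3000 < k) {ch : ℝ × ℝ → Bool} {i : ℕ} {x : ℝ}
    (h : x ∈ UU k ch i) : x ∉ BB k (i + 1) := by
  intro hB
  obtain ⟨m, hm, hx⟩ := mem_UU.1 h
  obtain ⟨n, hn, hx'⟩ := mem_BB.1 hB
  obtain ⟨m', hm', r, rfl, h1, h2⟩ := MM_succ_parent hn
  obtain ⟨r', hr, hr'⟩ := cI_form hk ch i m
  have e := cell_unique hx hx'
  rw [hr] at e
  have := pow_k hk
  have := pow_k1 hk
  have := (divmod_unique (by omega) (by omega) e).2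
  omega

lemma UU_disj {k : ℕ} (hk : 3000 < k) {ch : ℝ × ℝ → Bool} {i j : ℕ} {x : ℝ}
    (h : x ∈ UU k ch i) (h' : x ∈ UU k ch j) : i = j := by
  rcases lt_trichotomy i j with hij | hij | hij
  · exact absurd (BB_anti hk hij (UU_sub_BB hk h')) (UU_not_BB hk h)
  · exact hij
  · exact absurd (BB_anti hk hij (UU_sub_BB hk h)) (UU_not_BB hk h')

/-- points of `U j` are far from the boundary of their ancestors -/
lemma UU_far {k : ℕ} (hk : 3000 < k) {ch : ℝ × ℝ → Bool} {i j n : ℕ} {x y : ℝ}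
    (h : x ∈ UU k ch j) (hij : i ≤ j) (hn : x ∈ ivSet (cell k i n))
    (hy : |y - x| < dl k i / 4) : y ∈ ivSet (cell k i n) := by
  have := pow_k hk
  have := pow_k1 hk
  rcases hij.eq_or_lt with rfl | hlt
  · obtain ⟨m, hm, hx⟩ := mem_UU.1 h
    obtain rfl := cell_unique (UU_cell hk hx) hn
    obtain ⟨r', hr, hr'⟩ := cI_form hk ch i m
    rw [hr] at hx
    exact cell_parent_far hk hx (by omega) (by omega) hy
  · obtain ⟨n', hn', hx'⟩ := mem_BB.1 (BB_anti hk hlt (UU_sub_BB hk h))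
    obtain ⟨m', hm', r, rfl, h1, h2⟩ := MM_succ_parent hn'
    obtain rfl := cell_unique (cell_parent hx' (by omega)) hn
    exact cell_parent_far hk hx' (by omega) (by omega) hy

/-- small neighbourhoods of points of `U i` see only one interval `I(J)`. -/
lemma UU_small {k : ℕ} (hk : 3000 < k) {ch : ℝ × ℝ → Bool} {i j m : ℕ} {x y : ℝ}
    (hm : m ∈ MM k i) (hy : y ∈ ivSet (cell k (i + 1) (cI k ch i m)))
    (hxy : |x - y| < dl k (i + 1) / 4) (hx : x ∈ UU k ch j) :
    x ∈ ivSet (cell k (i + 1) (cI k ch i m)) := by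
  have hyU : y ∈ UU k ch i := mem_UU.2 ⟨m, hm, hy⟩
  rcases lt_trichotomy i j with hij | rfl | hij
  · obtain ⟨n, hn, hxn⟩ := mem_BB.1 (BB_anti hk (i := i + 1) hij (UU_sub_BB hk hx))
    rw [abs_sub_comm] at hxy
    have := UU_far hk hx hij hxn hxy
    rwa [cell_unique hy this]
  · obtain ⟨m', hm', hx'⟩ := mem_UU.1 hx
    have h1 := UU_far hk hyU le_rfl (UU_cell hk hy)
      (lt_of_lt_of_le hxy (by linarith [dl_anti k (Nat.le_succ i)]))
    have h2 := cell_unique h1 (UU_cell hk hx')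
    rwa [h2]
  · exfalso
    obtain ⟨n, hn, hyn⟩ := mem_BB.1 (BB_anti hk (i := j + 1) hij (UU_sub_BB hk hyU))
    have h1 := UU_far hk hyU hij hyn
      (lt_of_lt_of_le hxy (by linarith [dl_anti k (show j + 1 ≤ i + 1 by omega)]))
    exact UU_not_BB hk hx (mem_BB.2 ⟨n, hn, h1⟩)

lemma Kfam_eq {k : ℕ} (hk : 3000 < k) (i : ℕ) : Kfam k i = Set.image (cell k i) (MM k i) := by
  have e3 : ∀ i m, (3 : ℝ) ^ (1 - (k : ℤ)) * len (mid (cell k i m)) = dl k (i + 1) := by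
    intro i m
    have h1 : len (mid (cell k i m)) = dl k i / 3 := by
      simp only [len, mid, cell]; ring
    rw [h1, ← dl_succ k i, zpow_sub₀ (by norm_num)]
    simp
  induction i with
  | zero =>
    simp [Kfam, MM, cell, dl_zero]
  | succ i ih =>
    have key : ∀ m j : ℕ, ((mid (cell k i m)).1 + (j : ℝ) * dl k (i + 1),
             (mid (cell k i m)).1 + ((j : ℝ) + 1) * dl k (i + 1)) =
             cell k (i + 1) (m * 3 ^ k + 3 ^ (k - 1) + j) := by
      intro m j
      have h0 := dl_succ k i
      rw [pow_kR hk] at h0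
      simp only [mid, cell, Prod.mk.injEq]
      push_cast
      rw [← h0, pow_kR hk]
      constructor <;> ring
    ext I
    simp only [Kfam, ih, Set.mem_ofPred_eq, Set.exists_mem_image, e3, key]
    constructor
    · rintro ⟨m, hm, j, hj, rfl⟩
      exact ⟨_, ⟨m, hm, j, hj, rfl⟩, rfl⟩
    · rintro ⟨_, ⟨m, hm, j, hj, rfl⟩, rfl⟩
      exact ⟨m, hm, j, hj, rfl⟩

lemma IJ_eq {k : ℕ} (hk : 3000 < k) (ch : ℝ × ℝ → Bool) (i m : ℕ) :
    IJ k ch (mid (cell k i m)) = cell k (i + 1) (cI k ch i m) := by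
  have e3 : (3 : ℝ) ^ (1 - (k : ℤ)) * len (mid (cell k i m)) = dl k (i + 1) := by
    have h1 : len (mid (cell k i m)) = dl k i / 3 := by
      simp only [len, mid, cell]; ring
    rw [h1, ← dl_succ k i, zpow_sub₀ (by norm_num)]
    simp
  have h0 := dl_succ k i
  rw [pow_kR hk] at h0
  unfold IJ cI
  rw [e3]
  split_ifs
  · simp only [mid, cell, Prod.mk.injEq]
    push_cast
    rw [← h0, pow_kR hk]
    constructor <;> ring
  · have h27 := pow_k1 hk
    have : ((m * 3 ^ k + 3 ^ (k - 1) - 1 : ℕ) : ℝ) = m * 3 ^ k + 3 ^ (k - 1) - 1 := by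
      rw [Nat.cast_sub (by omega)]
      push_cast; ring
    simp only [mid, cell, Prod.mk.injEq, this]
    rw [← h0, pow_kR hk]
    constructor <;> ring

lemma mid_inj {I I' : ℝ × ℝ} (h : mid I = mid I') : I = I' := by
  simp only [mid, Prod.mk.injEq] at h
  ext <;> linarith [h.1, h.2]

lemma inner_tsum {k : ℕ} (hk : 3000 < k) (ch : ℝ × ℝ → Bool) (i : ℕ) (c x : ℝ) :
    ∑' J : ↥(Jfam k (i + 1)), Set.indicator (ivSet (IJ k ch (J : ℝ × ℝ))) (fun _ => c) x =
      (UU k ch i).indicator (fun _ => c) x := by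
  have hJ : ∀ J : ↥(Jfam k (i + 1)), ∃ m ∈ MM k i, (J : ℝ × ℝ) = mid (cell k i m) := by
    rintro ⟨J, K, hK, rfl⟩
    simp only [Nat.add_sub_cancel, Kfam_eq hk] at hK
    obtain ⟨m, hm, rfl⟩ := hK
    exact ⟨m, hm, rfl⟩
  by_cases hx : x ∈ UU k ch i
  · obtain ⟨m, hm, hx'⟩ := mem_UU.1 hx
    have hmem : mid (cell k i m) ∈ Jfam k (i + 1) := by
      refine ⟨cell k i m, ?_, rfl⟩
      rw [Nat.add_sub_cancel, Kfam_eq hk]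
      exact ⟨m, hm, rfl⟩
    rw [tsum_eq_single (⟨mid (cell k i m), hmem⟩ : ↥(Jfam k (i + 1)))]
    · rw [Set.indicator_of_mem hx, Set.indicator_of_mem]
      rwa [IJ_eq hk]
    · intro J hne
      obtain ⟨m', hm', e⟩ := hJ J
      apply Set.indicator_of_notMem
      intro hxJ
      rw [e, IJ_eq hk] at hxJ
      have := cell_unique (UU_cell hk hx') (UU_cell hk hxJ)
      subst this
      exact hne (Subtype.ext e)
  · rw [Set.indicator_of_notMem hx]
    convert tsum_zero with J
    obtain ⟨m', hm', e⟩ := hJ J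
    apply Set.indicator_of_notMem
    intro hxJ
    rw [e, IJ_eq hk] at hxJ
    exact hx (mem_UU.2 ⟨m', hm', hxJ⟩)

lemma wgt_eq {k : ℕ} (hk : 3000 < k) (ch : ℝ × ℝ → Bool) (x : ℝ) :
    wgt k ch x = ∑' i : ℕ, (UU k ch i).indicator (fun _ => aa k ^ (i + 1)) x := by
  unfold wgt
  congr 1; ext i
  exact inner_tsum hk ch i _ x

lemma wgt_mem {k : ℕ} (hk : 3000 < k) {ch : ℝ × ℝ → Bool} {x : ℝ} {i : ℕ} (h : x ∈ UU k ch i) :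
    wgt k ch x = aa k ^ (i + 1) := by
  rw [wgt_eq hk, tsum_eq_single i]
  · exact Set.indicator_of_mem h _
  · intro j hj
    apply Set.indicator_of_notMem
    intro hx
    exact hj (UU_disj hk hx h)

lemma wgt_notMem {k : ℕ} (hk : 3000 < k) {ch : ℝ × ℝ → Bool} {x : ℝ} (h : ∀ i, x ∉ UU k ch i) :
    wgt k ch x = 0 := by
  rw [wgt_eq hk]
  convert tsum_zero with i
  exact Set.indicator_of_notMem (h i) _

lemma aa_two {k : ℕ} (hk : 3000 < k) : 2 ≤ aa k := by
  unfold aa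
  rw [le_div_iff₀ (by positivity), pow_kR hk]
  linarith [pow_k1R hk]

lemma aa_three {k : ℕ} (hk : 3000 < k) : aa k ≤ 3 := by
  unfold aa
  rw [div_le_iff₀ (by positivity), pow_kR hk]
  linarith [pow_k1R hk]

lemma aa_eq {k : ℕ} : aa k * ((3 : ℝ) ^ (k - 1) + 1) = 3 ^ k := by
  unfold aa
  field_simp

lemma meas_UU (k : ℕ) (ch : ℝ × ℝ → Bool) (i : ℕ) : MeasurableSet (UU k ch i) :=
  MeasurableSet.biUnion (Set.to_countable _) fun _ _ => measurableSet_Ico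

/-! ### Mass bounds -/

lemma vol_cell (k i m : ℕ) : volume.real (ivSet (cell k i m)) = dl k i := by
  unfold ivSet cell
  rw [Real.volume_real_Ico]
  have := dl_pos k i
  rw [max_eq_left]
  · ring
  · nlinarith

lemma vol_cell_ne_top (k i m : ℕ) : volume (ivSet (cell k i m)) ≠ ⊤ := by
  unfold ivSet; simp

lemma cell_sub {k : ℕ} (hk : 3000 < k) {ch : ℝ × ℝ → Bool} {i m : ℕ} (hm : m ∈ MM k i) (j : ℕ) :
    ivSet (cell k i m) ∩ UU k ch j ⊆
      (if j = i then ivSet (cell k (i + 1) (cI k ch i m)) else ∅) ∪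
      ⋃ s ∈ Finset.range (3 ^ (k - 1)),
        (ivSet (cell k (i + 1) (m * 3 ^ k + 3 ^ (k - 1) + s)) ∩ UU k ch j) := by
  rintro x ⟨hx, hxU⟩
  have := pow_k hk
  have := pow_k1 hk
  rcases lt_trichotomy j i with hij | rfl | hij
  · exact absurd (BB_anti hk hij (mem_BB.2 ⟨m, hm, hx⟩)) (UU_not_BB hk hxU)
  · left
    obtain ⟨m', hm', hx'⟩ := mem_UU.1 hxU
    have := cell_unique hx (UU_cell hk hx')
    subst this
    simpa using hx'
  · right
    obtain ⟨n, hn, hxn⟩ := mem_BB.1 (BB_anti hk (i := i + 1) hij (UU_sub_BB hk hxU))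
    obtain ⟨m', hm', s, hs, rfl⟩ := hn
    have : m = m' := by
      rw [add_assoc] at hxn
      exact cell_unique hx (cell_parent hxn (by omega))
    subst this
    simp only [Set.mem_iUnion, Finset.mem_range]
    exact ⟨s, hs, hxn, hxU⟩

lemma cell_mass {k : ℕ} (hk : 3000 < k) (ch : ℝ × ℝ → Bool) (N d : ℕ) :
    ∀ i m : ℕ, N ≤ i + d → m ∈ MM k i →
    ∑ j ∈ Finset.range N, aa k ^ (j + 1) * volume.real (ivSet (cell k i m) ∩ UU k ch j) ≤
      aa k ^ i * dl k i := by
  have ha : 0 ≤ aa k := by linarith [aa_two hk]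
  induction d with
  | zero =>
    intro i m hi hm
    refine le_trans (le_of_eq ?_) (by have := dl_pos k i; positivity)
    apply Finset.sum_eq_zero
    intro j hj
    rw [Finset.mem_range] at hj
    have : ivSet (cell k i m) ∩ UU k ch j = ∅ := by
      ext x
      simp only [Set.mem_inter_iff, Set.mem_empty_iff_false, iff_false, not_and]
      intro hx hxU
      exact absurd (BB_anti hk (i := j + 1) (by omega) (mem_BB.2 ⟨m, hm, hx⟩)) (UU_not_BB hk hxU)
    simp [this]
  | succ d ih =>
    intro i m hi hm
    have step : ∀ j, volume.real (ivSet (cell k i m) ∩ UU k ch j) ≤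
        (if j = i then dl k (i + 1) else 0) + ∑ s ∈ Finset.range (3 ^ (k - 1)),
          volume.real (ivSet (cell k (i + 1) (m * 3 ^ k + 3 ^ (k - 1) + s)) ∩ UU k ch j) := by
      intro j
      refine (measureReal_mono (cell_sub hk hm j) ?_).trans ?_
      · apply ne_of_lt
        refine (measure_union_le _ _).trans_lt (ENNReal.add_lt_top.2 ⟨?_, ?_⟩)
        · split_ifs
          · exact (vol_cell_ne_top _ _ _).lt_top
          · simp
        · refine measure_biUnion_lt_top (Finset.finite_toSet _) fun s _ => ?_
          exact (measure_mono Set.inter_subset_left).trans_lt (vol_cell_ne_top _ _ _).lt_top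
      · refine (measureReal_union_le _ _).trans (add_le_add ?_ (measureReal_biUnion_finset_le _ _))
        split_ifs
        · rw [vol_cell]
        · simp
    calc _ ≤ ∑ j ∈ Finset.range N, aa k ^ (j + 1) *
          ((if j = i then dl k (i + 1) else 0) + ∑ s ∈ Finset.range (3 ^ (k - 1)),
          volume.real (ivSet (cell k (i + 1) (m * 3 ^ k + 3 ^ (k - 1) + s)) ∩ UU k ch j)) := by
          gcongr with j hj; exact step j
      _ = (∑ j ∈ Finset.range N, if j = i then aa k ^ (i + 1) * dl k (i + 1) else 0) +
          ∑ s ∈ Finset.range (3 ^ (k - 1)), ∑ j ∈ Finset.range N, aa k ^ (j + 1) *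
          volume.real (ivSet (cell k (i + 1) (m * 3 ^ k + 3 ^ (k - 1) + s)) ∩ UU k ch j) := by
          rw [Finset.sum_comm, ← Finset.sum_add_distrib]
          apply Finset.sum_congr rfl
          intro j _
          rw [mul_add, Finset.mul_sum]
          congr 1
          split_ifs with h
          · rw [h]
          · simp
      _ ≤ aa k ^ (i + 1) * dl k (i + 1) +
          ∑ s ∈ Finset.range (3 ^ (k - 1)), aa k ^ (i + 1) * dl k (i + 1) := by
          have := dl_pos k (i + 1)
          gcongr with s hs
          · rw [Finset.sum_ite_eq']
            split_ifs
            · exact le_rfl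
            · positivity
          · exact ih (i + 1) _ (by omega) ⟨m, hm, s, Finset.mem_range.1 hs, rfl⟩
      _ = aa k ^ i * dl k i := by
          rw [Finset.sum_const, Finset.card_range, nsmul_eq_mul, ← dl_succ k i, ← aa_eq]
          push_cast
          ring

lemma wgt_nonneg {k : ℕ} (hk : 3000 < k) (ch : ℝ × ℝ → Bool) (x : ℝ) : 0 ≤ wgt k ch x := by
  have ha : 0 ≤ aa k := by linarith [aa_two hk]
  rw [wgt_eq hk]
  exact tsum_nonneg fun i => Set.indicator_nonneg (fun _ _ => by positivity) _

lemma wgt_enn {k : ℕ} (hk : 3000 < k) (ch : ℝ × ℝ → Bool) (x : ℝ) :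
    ENNReal.ofReal (wgt k ch x) =
      ∑' i : ℕ, (UU k ch i).indicator (fun _ => ENNReal.ofReal (aa k ^ (i + 1))) x := by
  by_cases h : ∃ i, x ∈ UU k ch i
  · obtain ⟨i, hi⟩ := h
    rw [wgt_mem hk hi, tsum_eq_single i]
    · rw [Set.indicator_of_mem hi]
    · intro j hj
      apply Set.indicator_of_notMem
      intro hx
      exact hj (UU_disj hk hx hi)
  · push Not at h
    rw [wgt_notMem hk h]
    simp only [ENNReal.ofReal_zero]
    symm
    rw [ENNReal.tsum_eq_zero]
    intro i
    exact Set.indicator_of_notMem (h i) _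

lemma wgt_meas {k : ℕ} (hk : 3000 < k) (ch : ℝ × ℝ → Bool) : Measurable (wgt k ch) := by
  have : wgt k ch = fun x => (ENNReal.ofReal (wgt k ch x)).toReal := by
    ext x; rw [ENNReal.toReal_ofReal (wgt_nonneg hk ch x)]
  rw [this]
  apply Measurable.ennreal_toReal
  simp only [wgt_enn hk]
  exact Measurable.tsum fun i => measurable_const.indicator (meas_UU k ch i)

lemma cell_lint {k : ℕ} (hk : 3000 < k) (ch : ℝ × ℝ → Bool) {i m : ℕ} (hm : m ∈ MM k i) :
    ∫⁻ x in ivSet (cell k i m), ENNReal.ofReal (wgt k ch x) ≤ ENNReal.ofReal (aa k ^ i * dl k i) := by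
  have ha : 0 ≤ aa k := by linarith [aa_two hk]
  simp only [wgt_enn hk]
  rw [lintegral_tsum fun i => (measurable_const.indicator (meas_UU k ch i)).aemeasurable]
  apply ENNReal.tsum_le_of_sum_range_le
  intro N
  refine le_trans (le_of_eq ?_) (ENNReal.ofReal_le_ofReal (cell_mass hk ch N N i m (by omega) hm))
  rw [ENNReal.ofReal_sum_of_nonneg (fun j _ => by positivity)]
  apply Finset.sum_congr rfl
  intro j _
  rw [lintegral_indicator (meas_UU k ch j), setLIntegral_const,
    Measure.restrict_apply (meas_UU k ch j), ENNReal.ofReal_mul (by positivity), Set.inter_comm,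
    measureReal_def, ENNReal.ofReal_toReal]
  exact ((measure_mono Set.inter_subset_left).trans_lt (vol_cell_ne_top _ _ _).lt_top).ne

lemma BB_zero {k : ℕ} : BB k 0 = Set.Ico 0 1 := by
  simp [BB, MM, cell, ivSet, dl_zero]

lemma UU_unit {k : ℕ} (hk : 3000 < k) {ch : ℝ × ℝ → Bool} {x : ℝ} {i : ℕ} (h : x ∈ UU k ch i) :
    x ∈ Set.Ico (0 : ℝ) 1 := by
  rw [← BB_zero (k := k)]
  exact BB_anti hk (Nat.zero_le i) (UU_sub_BB hk h)

lemma wgt_int {k : ℕ} (hk : 3000 < k) (ch : ℝ × ℝ → Bool) : Integrable (wgt k ch) := by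
  have h0 : ivSet (cell k 0 0) = Set.Ico 0 1 := by simp [cell, ivSet, dl_zero]
  have : IntegrableOn (wgt k ch) (Set.Ico 0 1) := by
    refine ⟨(wgt_meas hk ch).aestronglyMeasurable, ?_⟩
    rw [hasFiniteIntegral_iff_ofReal (Filter.Eventually.of_forall (wgt_nonneg hk ch))]
    rw [← h0]
    exact (cell_lint hk ch (i := 0) (m := 0) (by simp [MM])).trans_lt ENNReal.ofReal_lt_top
  rw [← integrableOn_iff_integrable_of_support_subset (s := Set.Ico 0 1)]
  · exact this
  · intro x hx
    by_contra hx'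
    apply hx
    exact wgt_notMem hk fun i hi => hx' (UU_unit hk hi)

lemma cell_int {k : ℕ} (hk : 3000 < k) (ch : ℝ × ℝ → Bool) {i m : ℕ} (hm : m ∈ MM k i) :
    ∫ x in ivSet (cell k i m), wgt k ch x ≤ aa k ^ i * dl k i := by
  have ha : 0 ≤ aa k := by linarith [aa_two hk]
  rw [integral_eq_lintegral_of_nonneg_ae (Filter.Eventually.of_forall (wgt_nonneg hk ch))
    (wgt_meas hk ch).aestronglyMeasurable]
  refine ENNReal.toReal_le_of_le_ofReal ?_ (cell_lint hk ch hm)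
  have := dl_pos k i
  positivity

lemma vol_iv {R : ℝ × ℝ} (h : R.1 < R.2) : volume.real (ivSet R) = len R := by
  unfold ivSet len
  rw [Real.volume_real_Ico, max_eq_left (by linarith)]

lemma mass_le {k : ℕ} (hk : 3000 < k) (ch : ℝ × ℝ → Bool) {R : ℝ × ℝ} (h0 : 0 ≤ R.1)
    (hR : R.1 < R.2) (i : ℕ) (hi : dl k i / 4 ≤ len R) :
    mass (wgt k ch) R ≤ 10 * aa k ^ i * len R := by
  classical
  have ha : 1 ≤ aa k := by linarith [aa_two hk]
  have hd := dl_pos k i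
  let T : Finset ℕ := (Finset.Icc ⌊R.1 / dl k i⌋₊ ⌊R.2 / dl k i⌋₊).filter (· ∈ MM k i)
  have hintg := wgt_int hk ch
  have hpt : ∀ x, (ivSet R).indicator (wgt k ch) x ≤
      (ivSet R).indicator (fun _ => aa k ^ i) x +
      ∑ m ∈ T, (ivSet (cell k i m)).indicator (wgt k ch) x := by
    intro x
    have hs : 0 ≤ ∑ m ∈ T, (ivSet (cell k i m)).indicator (wgt k ch) x :=
      Finset.sum_nonneg fun m _ => Set.indicator_nonneg (fun _ _ => wgt_nonneg hk ch _) _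
    by_cases hx : x ∈ ivSet R
    · rw [Set.indicator_of_mem hx, Set.indicator_of_mem hx]
      by_cases hU : ∃ j, x ∈ UU k ch j
      · obtain ⟨j, hj⟩ := hU
        by_cases hji : j < i
        · rw [wgt_mem hk hj]
          have : aa k ^ (j + 1) ≤ aa k ^ i := pow_le_pow_right₀ ha hji
          linarith
        · obtain ⟨m, hm, hxm⟩ := mem_BB.1 (BB_anti hk (not_lt.1 hji) (UU_sub_BB hk hj))
          have hmT : m ∈ T := by
            simp only [T, Finset.mem_filter, Finset.mem_Icc]
            rw [mem_cell] at hxm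
            have hx2 : R.1 ≤ x ∧ x < R.2 := hx
            refine ⟨⟨?_, ?_⟩, hm⟩
            · have : R.1 / dl k i < m + 1 := by
                rw [div_lt_iff₀ hd]; linarith
              have := (Nat.floor_lt (by positivity)).2 (by exact_mod_cast this :
                R.1 / dl k i < ((m + 1 : ℕ) : ℝ))
              omega
            · apply Nat.le_floor
              rw [le_div_iff₀ hd]; linarith
          have := Finset.single_le_sum
            (f := fun m => (ivSet (cell k i m)).indicator (wgt k ch) x)
            (fun m _ => Set.indicator_nonneg (fun _ _ => wgt_nonneg hk ch _) _) hmT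
          simp only [Set.indicator_of_mem hxm] at this
          have : 0 ≤ aa k ^ i := by positivity
          linarith
      · push Not at hU
        rw [wgt_notMem hk hU]
        positivity
    · rw [Set.indicator_of_notMem hx, Set.indicator_of_notMem hx]
      linarith
  have hmeas : ∀ I : ℝ × ℝ, MeasurableSet (ivSet I) := fun I => measurableSet_Ico
  have hvf : volume (ivSet R) ≠ ⊤ := by unfold ivSet; simp
  unfold mass
  rw [← integral_indicator (hmeas R)]
  refine (integral_mono (hintg.indicator (hmeas R)) ?_ hpt).trans ?_
  · refine Integrable.add ?_ (integrable_finsetSum _ fun m _ => hintg.indicator (hmeas _))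
    exact (integrable_indicator_iff (hmeas R)).2 (integrableOn_const hvf)
  rw [integral_add ((integrable_indicator_iff (hmeas R)).2 (integrableOn_const hvf))
    (integrable_finsetSum _ fun m _ => hintg.indicator (hmeas _)),
    integral_finsetSum _ fun m _ => hintg.indicator (hmeas _)]
  simp only [integral_indicator (hmeas _), setIntegral_const, vol_iv hR, smul_eq_mul]
  have h1 : ∑ m ∈ T, ∫ x in ivSet (cell k i m), wgt k ch x ≤ T.card * (aa k ^ i * dl k i) := by
    rw [← nsmul_eq_mul]
    apply Finset.sum_le_card_nsmul
    intro m hm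
    exact cell_int hk ch (Finset.mem_filter.1 hm).2
  have h2 : (T.card : ℝ) * dl k i ≤ len R + 2 * dl k i := by
    have hc : T.card ≤ ⌊R.2 / dl k i⌋₊ + 1 - ⌊R.1 / dl k i⌋₊ := by
      refine (Finset.card_filter_le _ _).trans ?_
      rw [Nat.card_Icc]
    have hle : ⌊R.1 / dl k i⌋₊ ≤ ⌊R.2 / dl k i⌋₊ := Nat.floor_le_floor (by gcongr)
    have hc' : T.card + ⌊R.1 / dl k i⌋₊ ≤ ⌊R.2 / dl k i⌋₊ + 1 := by omega
    have hc2 : (T.card : ℝ) + ⌊R.1 / dl k i⌋₊ ≤ ⌊R.2 / dl k i⌋₊ + 1 := by exact_mod_cast hc'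
    have f1 := Nat.lt_floor_add_one (R.1 / dl k i)
    have f2 := Nat.floor_le (show 0 ≤ R.2 / dl k i by have : 0 ≤ R.2 := by linarith
                                                      positivity)
    have : (T.card : ℝ) ≤ R.2 / dl k i - R.1 / dl k i + 2 := by linarith
    calc (T.card : ℝ) * dl k i ≤ (R.2 / dl k i - R.1 / dl k i + 2) * dl k i := by gcongr
      _ = len R + 2 * dl k i := by unfold len; field_simp
  have h3 : (T.card : ℝ) * (aa k ^ i * dl k i) ≤ aa k ^ i * (len R + 2 * dl k i) := by
    calc _ = aa k ^ i * (T.card * dl k i) := by ring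
      _ ≤ _ := by gcongr
  have h4 : aa k ^ i * (len R + 2 * dl k i) ≤ aa k ^ i * (9 * len R) := by
    gcongr
    linarith
  linarith

lemma avg_le {k : ℕ} (hk : 3000 < k) (ch : ℝ × ℝ → Bool) {R : ℝ × ℝ} (h0 : 0 ≤ R.1)
    (hR : R.1 < R.2) (i : ℕ) (hi : dl k i / 4 ≤ len R) :
    avg (wgt k ch) R ≤ 10 * aa k ^ i := by
  unfold avg
  rw [div_le_iff₀ (by unfold len; linarith)]
  exact mass_le hk ch h0 hR i hi

/-! ### Reduction from sparse families to disjoint major subsets -/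

lemma iv_meas (I : ℝ × ℝ) : MeasurableSet (ivSet I) := measurableSet_Ico

lemma iv_ne_top (I : ℝ × ℝ) : volume (ivSet I) ≠ ⊤ := by unfold ivSet; simp

lemma iv_sub {I J : ℝ × ℝ} (hI : I.1 < I.2) (h : ivSet I ⊆ ivSet J) : J.1 ≤ I.1 ∧ I.2 ≤ J.2 :=
  (Set.Ico_subset_Ico_iff hI).1 h

lemma iv_inj {I J : ℝ × ℝ} (hI : I.1 < I.2) (hJ : J.1 < J.2) (h : ivSet I = ivSet J) : I = J := by
  have h1 := iv_sub hI h.subset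
  have h2 := iv_sub hJ h.symm.subset
  ext <;> linarith [h1.1, h1.2, h2.1, h2.2]

def ER (S : Set (ℝ × ℝ)) (R : ℝ × ℝ) : Set ℝ := ivSet R \ ⋃ Q ∈ maxIn S R, ivSet Q

lemma ER_vol {ε : ℝ} {S : Set (ℝ × ℝ)} (hS : MSparse ε S) {R : ℝ × ℝ} (hR : R ∈ S) :
    MeasurableSet (ER S R) ∧ (1 - ε) * len R ≤ volume.real (ER S R) := by
  obtain ⟨hc, hpos, hnest, hsp⟩ := hS
  have hsub : maxIn S R ⊆ S := fun Q hQ => hQ.1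
  have hcm : (maxIn S R).Countable := hc.mono hsub
  have hmU : MeasurableSet (⋃ Q ∈ maxIn S R, ivSet Q) :=
    MeasurableSet.biUnion hcm fun Q _ => iv_meas Q
  have hUs : (⋃ Q ∈ maxIn S R, ivSet Q) ⊆ ivSet R :=
    Set.iUnion₂_subset fun Q hQ => hQ.2.1.subset
  have hdis : (maxIn S R).PairwiseDisjoint ivSet := by
    intro Q hQ Q' hQ' hne
    rcases hnest Q hQ.1 Q' hQ'.1 with h | h | h
    · exact absurd (iv_inj (hpos _ hQ.1) (hpos _ hQ'.1) (hQ.2.2 Q' hQ'.1 h hQ'.2.1).symm) hne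
    · exact absurd (iv_inj (hpos _ hQ.1) (hpos _ hQ'.1) (hQ'.2.2 Q hQ.1 h hQ.2.1)) hne
    · exact Set.disjoint_iff_inter_eq_empty.2 h
  have hvol : volume.real (⋃ Q ∈ maxIn S R, ivSet Q) = ∑' Q : ↥(maxIn S R), len (Q : ℝ × ℝ) := by
    rw [measureReal_def, measure_biUnion hcm hdis fun Q _ => iv_meas Q,
      ENNReal.tsum_toReal_eq fun Q => iv_ne_top _]
    congr 1; ext Q
    exact vol_iv (hpos _ (hsub Q.2))
  refine ⟨(iv_meas R).diff hmU, ?_⟩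
  unfold ER
  rw [measureReal_sdiff hUs hmU (iv_ne_top R), hvol, vol_iv (hpos R hR)]
  have := hsp R hR
  linarith

lemma avg_nonneg {u : ℝ → ℝ} (hu : ∀ x, 0 ≤ u x) {R : ℝ × ℝ} (hR : R.1 < R.2) : 0 ≤ avg u R :=
  div_nonneg (integral_nonneg hu) (by unfold len; linarith)

lemma mass_mono {u : ℝ → ℝ} (hu : ∀ x, 0 ≤ u x) (hi : Integrable u) {R Q : ℝ × ℝ}
    (h : ivSet R ⊆ ivSet Q) : mass u R ≤ mass u Q :=
  setIntegral_mono_set hi.integrableOn (Filter.Eventually.of_forall hu) h.eventuallyLE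

lemma reduction {q : ℝ} (hq : 0 < q) {u v : ℝ → ℝ} (hu : ∀ x, 0 ≤ u x) (hv : ∀ x, 0 ≤ v x)
    (hui : Integrable u) (hvi : Integrable v) {ε : ℝ} (hε : ε < 1) {S : Set (ℝ × ℝ)}
    (hS : MSparse ε S) {L : ℝ × ℝ} (hL0 : 0 ≤ L.1) (hL1 : L.2 ≤ 1) {B : ℝ} (hB : 0 ≤ B)
    (H : ∀ (T : Finset (ℝ × ℝ)) (E : ℝ × ℝ → Set ℝ),
      (∀ R ∈ T, R.1 < R.2 ∧ ivSet R ⊆ ivSet L ∧ E R ⊆ ivSet R ∧ MeasurableSet (E R)) →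
      (T : Set (ℝ × ℝ)).PairwiseDisjoint E →
      ∑ R ∈ T, avg u R ^ q * avg v R * volume.real (E R) ≤ B) :
    sumTest q u v {I | I ∈ S ∧ ivSet I ⊆ ivSet L} ≤ B / (1 - ε) := by
  classical
  have hε' : 0 < 1 - ε := by linarith
  unfold sumTest
  set f : ℝ × ℝ → ℝ := fun I => avg u I ^ q * avg v I * len I with hf
  set F : Set (ℝ × ℝ) := {I | I ∈ S ∧ ivSet I ⊆ ivSet L} with hF
  have hpos : ∀ I ∈ F, I.1 < I.2 := fun I hI => hS.2.1 I hI.1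
  have hlen : ∀ I ∈ F, 0 < len I := fun I hI => by unfold len; linarith [hpos I hI]
  have hlen1 : ∀ I ∈ F, len I ≤ 1 := fun I hI => by
    have := iv_sub (hpos I hI) hI.2
    unfold len; linarith
  have hfnn : ∀ I ∈ F, 0 ≤ f I := fun I hI => by
    have h1 := avg_nonneg hu (hpos I hI)
    have h2 := avg_nonneg hv (hpos I hI)
    have h3 := hlen I hI
    simp only [hf]; positivity
  by_cases hsum : Summable (fun I : ↥F => f I)
  swap
  · rw [tsum_eq_zero_of_not_summable hsum]
    positivity
  -- the members with positive contribution
  have hmax : ∀ R ∈ F, ∀ R' ∈ F, 0 < f R → ivSet R ⊂ ivSet R' →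
      ∃ Q ∈ maxIn S R', ivSet R ⊆ ivSet Q := by
    intro R hR R' hR' hfR hss
    have hmu : 0 < mass u R := by
      rcases (avg_nonneg hu (hpos R hR)).eq_or_lt with h | h
      · simp [hf, ← h, Real.zero_rpow hq.ne'] at hfR
      · unfold avg at h
        exact (div_pos_iff_of_pos_right (hlen R hR)).1 h
    have hmv : 0 < mass v R := by
      rcases (avg_nonneg hv (hpos R hR)).eq_or_lt with h | h
      · simp [hf, ← h] at hfR
      · unfold avg at h
        exact (div_pos_iff_of_pos_right (hlen R hR)).1 h
    set c := mass u R ^ q * mass v R with hc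
    have hcpos : 0 < c := by positivity
    have hlow : ∀ Q ∈ F, ivSet R ⊆ ivSet Q → c ≤ f Q := by
      intro Q hQ hRQ
      have h1 := mass_mono hu hui hRQ
      have h2 := mass_mono hv hvi hRQ
      have h3 := hlen Q hQ
      have h4 : mass u Q ≤ avg u Q := by
        unfold avg; rw [le_div_iff₀ h3]
        have := hlen1 Q hQ
        nlinarith
      have h5 : avg v Q * len Q = mass v Q := by unfold avg; field_simp
      simp only [hf, mul_assoc, h5, hc]
      have h6 : 0 ≤ avg u Q := avg_nonneg hu (hpos Q hQ)
      exact mul_le_mul (Real.rpow_le_rpow hmu.le (h1.trans h4) hq.le) h2 hmv.le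
        (Real.rpow_nonneg h6 _)
    have hfin : {Q : ↥F | ivSet R ⊆ ivSet (Q : ℝ × ℝ)}.Finite := by
      have ht := hsum.tendsto_cofinite_zero
      have := (ht.eventually (gt_mem_nhds hcpos))
      rw [Filter.eventually_cofinite] at this
      refine this.subset ?_
      intro Q hQ
      exact not_lt.2 (hlow Q Q.2 hQ)
    have hfin2 : {Q : ℝ × ℝ | Q ∈ S ∧ ivSet R ⊆ ivSet Q ∧ ivSet Q ⊂ ivSet R'}.Finite := by
      refine (hfin.image Subtype.val).subset ?_
      rintro Q ⟨h1, h2, h3⟩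
      exact ⟨⟨Q, h1, h3.subset.trans hR'.2⟩, h2, rfl⟩
    obtain ⟨Q, ⟨hQ1, hQ2, hQ3⟩, hQm⟩ := Set.exists_max_image _ len hfin2
      ⟨R, hR.1, subset_rfl, hss⟩
    refine ⟨Q, ⟨hQ1, hQ3, ?_⟩, hQ2⟩
    intro Q' hQ' hs hss'
    have h1 := hQm Q' ⟨hQ', hQ2.trans hs, hss'⟩
    have h2 := iv_sub (hS.2.1 Q hQ1) hs
    have : Q' = Q := by
      unfold len at h1
      ext <;> linarith [h2.1, h2.2]
    rw [this]
  have hdisj : ∀ R ∈ F, ∀ R' ∈ F, 0 < f R → 0 < f R' → R ≠ R' → Disjoint (ER S R) (ER S R') := by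
    have aux : ∀ R ∈ F, ∀ R' ∈ F, 0 < f R → R ≠ R' → ivSet R ⊆ ivSet R' →
        Disjoint (ER S R) (ER S R') := by
      intro R hR R' hR' hfR hne hs
      have hss : ivSet R ⊂ ivSet R' :=
        hs.ssubset_of_ne fun h => hne (iv_inj (hpos R hR) (hpos R' hR') h)
      obtain ⟨Q, hQ, hRQ⟩ := hmax R hR R' hR' hfR hss
      rw [Set.disjoint_left]
      intro x hx hx'
      exact hx'.2 (Set.mem_biUnion hQ (hRQ hx.1))
    intro R hR R' hR' h h' hne
    rcases hS.2.2.1 R hR.1 R' hR'.1 with hh | hh | hh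
    · exact aux R hR R' hR' h hne hh
    · exact (aux R' hR' R hR h' hne.symm hh).symm
    · exact (Set.disjoint_iff_inter_eq_empty.2 hh).mono Set.sdiff_subset Set.sdiff_subset
  refine hsum.tsum_le_of_sum_le fun s => ?_
  set T : Finset (ℝ × ℝ) := (s.map (Function.Embedding.subtype _)).filter (fun I => 0 < f I) with hT
  have hTF : ∀ R ∈ T, R ∈ F ∧ 0 < f R := by
    intro R hR
    simp only [hT, Finset.mem_filter, Finset.mem_map, Function.Embedding.subtype_apply] at hR
    obtain ⟨⟨Q, _, rfl⟩, h⟩ := hR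
    exact ⟨Q.2, h⟩
  have hs1 : ∑ I ∈ s, f I = ∑ I ∈ T, f I := by
    rw [hT, Finset.sum_filter_of_ne, Finset.sum_map]
    · rfl
    · intro R hR hne
      simp only [Finset.mem_map, Function.Embedding.subtype_apply] at hR
      obtain ⟨Q, _, rfl⟩ := hR
      exact (hfnn Q Q.2).lt_of_ne' hne
  have key := H T (ER S) (fun R hR => ⟨hpos R (hTF R hR).1, (hTF R hR).1.2, Set.sdiff_subset,
    (ER_vol hS (hTF R hR).1.1).1⟩) (fun R hR R' hR' hne =>
      hdisj R (hTF R hR).1 R' (hTF R' hR').1 (hTF R hR).2 (hTF R' hR').2 hne)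
  change ∑ I ∈ s, f I ≤ _
  rw [hs1, le_div_iff₀ hε', Finset.sum_mul]
  refine le_trans (Finset.sum_le_sum fun R hR => ?_) key
  have h1 := avg_nonneg hu (hpos R (hTF R hR).1)
  have h2 := avg_nonneg hv (hpos R (hTF R hR).1)
  have h3 := (ER_vol hS (hTF R hR).1.1).2
  calc f R * (1 - ε) = avg u R ^ q * avg v R * ((1 - ε) * len R) := by simp only [hf]; ring
    _ ≤ _ := by gcongr

/-! ### The two basic sums -/

lemma small_sum (T : Finset (ℝ × ℝ)) (E : ℝ × ℝ → Set ℝ) (L Q : ℝ × ℝ)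
    (hT : ∀ R ∈ T, R.1 < R.2 ∧ ivSet R ⊆ ivSet L ∧ E R ⊆ ivSet R ∧ MeasurableSet (E R))
    (hE : (T : Set (ℝ × ℝ)).PairwiseDisjoint E) :
    ∑ R ∈ T, (volume.real (ivSet R ∩ ivSet Q) / len R) ^ 2 * volume.real (E R) ≤
      8 * Real.pi * volume.real (ivSet L ∩ ivSet Q) := by
  set c := max L.1 Q.1 with hc
  set e := min L.2 Q.2 with he
  have hG : ivSet L ∩ ivSet Q = Set.Ico c e := by
    unfold ivSet; rw [Set.Ico_inter_Ico]
  have hRG : ∀ R ∈ T, ivSet R ∩ ivSet Q = ivSet R ∩ Set.Ico c e := by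
    intro R hR
    rw [← hG]
    ext x
    constructor
    · rintro ⟨h1, h2⟩; exact ⟨h1, (hT R hR).2.1 h1, h2⟩
    · rintro ⟨h1, h2, h3⟩; exact ⟨h1, h3⟩
  rw [hG]
  by_cases hce : c < e
  swap
  · have : Set.Ico c e = ∅ := Set.Ico_eq_empty hce
    rw [this]
    refine le_of_eq_of_le (Finset.sum_eq_zero fun R hR => ?_) (by simp)
    rw [hRG R hR, this]; simp
  have hvG : volume.real (Set.Ico c e) = e - c := by
    rw [Real.volume_real_Ico, max_eq_left (by linarith)]
  rw [hvG]
  set l := e - c with hl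
  have hl0 : 0 < l := by linarith
  set μ := (c + e) / 2 with hμ
  set g : ℝ → ℝ := fun x => 16 * (1 + ((x - μ) * (2 / l)) ^ 2)⁻¹ with hg
  have hg0 : ∀ x, 0 ≤ g x := fun x => by simp only [hg]; positivity
  have hgi : Integrable g := by
    have h1 : Integrable (fun x : ℝ => (1 + x ^ 2)⁻¹) := integrable_inv_one_add_sq
    have h2 := h1.comp_mul_right' (R := 2 / l) (by positivity)
    exact (h2.comp_sub_right μ).const_mul 16
  have hgI : ∫ x, g x = 8 * Real.pi * l := by
    simp only [hg]
    rw [integral_const_mul, integral_sub_right_eq_self (fun x : ℝ => (1 + (x * (2 / l)) ^ 2)⁻¹) μ,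
      Measure.integral_comp_mul_right (fun x : ℝ => (1 + x ^ 2)⁻¹), integral_univ_inv_one_add_sq,
      abs_of_pos (by positivity)]
    simp
    ring
  have hpt : ∀ R ∈ T, ∀ x ∈ ivSet R, (volume.real (ivSet R ∩ ivSet Q) / len R) ^ 2 ≤ g x := by
    intro R hR x hx
    rw [hRG R hR]
    have hlen : 0 < len R := by unfold len; linarith [(hT R hR).1]
    rcases Set.eq_empty_or_nonempty (ivSet R ∩ Set.Ico c e) with h0 | ⟨z, hz1, hz2⟩
    · rw [h0]; simpa using hg0 x
    set θ := volume.real (ivSet R ∩ Set.Ico c e) / len R with hθ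
    have hθ0 : 0 ≤ θ := by positivity
    have hθ1 : θ ≤ 1 := by
      rw [hθ, div_le_one hlen, ← vol_iv (hT R hR).1]
      exact measureReal_mono Set.inter_subset_left (iv_ne_top R)
    have hθ2 : θ * len R ≤ l := by
      rw [hθ, div_mul_cancel₀ _ hlen.ne', ← hvG]
      exact measureReal_mono Set.inter_subset_right (by simp)
    have hx' : R.1 ≤ x ∧ x < R.2 := hx
    have hz' : R.1 ≤ z ∧ z < R.2 := hz1
    have hzz : c ≤ z ∧ z < e := hz2
    have habs : |x - μ| ≤ len R + l / 2 := by
      rw [abs_le]; unfold len; constructor <;> linarith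
    have h2 : θ * (|x - μ| + l / 2) ≤ 2 * l := by
      calc θ * (|x - μ| + l / 2) ≤ θ * (len R + l) :=
            mul_le_mul_of_nonneg_left (by linarith) hθ0
        _ = θ * len R + θ * l := by ring
        _ ≤ l + 1 * l := by gcongr
        _ = 2 * l := by ring
    have h3 : θ ^ 2 * ((x - μ) ^ 2 + (l / 2) ^ 2) ≤ (2 * l) ^ 2 := by
      calc θ ^ 2 * ((x - μ) ^ 2 + (l / 2) ^ 2) ≤ (θ * (|x - μ| + l / 2)) ^ 2 := by
            rw [← sq_abs (x - μ), mul_pow]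
            gcongr
            nlinarith [abs_nonneg (x - μ)]
        _ ≤ _ := by gcongr
    simp only [hg]
    rw [← div_eq_mul_inv, le_div_iff₀ (by positivity)]
    have : θ ^ 2 * (1 + ((x - μ) * (2 / l)) ^ 2) =
        (θ ^ 2 * ((x - μ) ^ 2 + (l / 2) ^ 2)) * (4 / l ^ 2) := by
      field_simp; ring
    rw [this]
    calc _ ≤ (2 * l) ^ 2 * (4 / l ^ 2) := by gcongr
      _ = 16 := by field_simp; ring
  calc _ ≤ ∑ R ∈ T, ∫ x in E R, g x := by
        apply Finset.sum_le_sum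
        intro R hR
        obtain ⟨h1, h2, h3, h4⟩ := hT R hR
        have hfin : volume (E R) ≠ ⊤ := ((measure_mono h3).trans_lt (iv_ne_top R).lt_top).ne
        rw [mul_comm, ← smul_eq_mul, ← setIntegral_const]
        exact setIntegral_mono_on (integrableOn_const hfin) hgi.integrableOn h4
          fun x hx => hpt R hR x (h3 hx)
    _ = ∫ x in ⋃ R ∈ T, E R, g x :=
        (integral_biUnion_finset T (fun R hR => (hT R hR).2.2.2) hE
          fun R _ => hgi.integrableOn).symm
    _ ≤ ∫ x, g x := setIntegral_le_integral hgi (Filter.Eventually.of_forall hg0)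
    _ = _ := hgI

lemma sum_div_range (g : ℕ → ℝ) (k : ℕ) (hk : 0 < k) (n : ℕ) :
    ∑ t ∈ Finset.range (n * k), g (t / k) = k * ∑ i ∈ Finset.range n, g i := by
  induction n with
  | zero => simp
  | succ n ih =>
    rw [Nat.succ_mul, Finset.sum_range_add, ih, Finset.sum_range_succ, mul_add]
    congr 1
    rw [Finset.sum_congr rfl (g := fun _ => g n), Finset.sum_const, Finset.card_range, nsmul_eq_mul]
    intro s hs
    rw [Finset.mem_range] at hs
    congr 1
    rw [mul_comm, Nat.mul_add_div hk, Nat.div_eq_of_lt hs, add_zero]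

lemma geom_le (b : ℝ) (hb : 2 ≤ b) (n : ℕ) : ∑ i ∈ Finset.range (n + 1), b ^ i ≤ 2 * b ^ n := by
  induction n with
  | zero => simp
  | succ n ih =>
    rw [Finset.sum_range_succ, pow_succ]
    have : 0 ≤ b ^ n := by positivity
    nlinarith

lemma scale_exists {ℓ : ℝ} {N : ℕ} (h1 : ((3 : ℝ) ^ N)⁻¹ / 4 ≤ ℓ) (h2 : ℓ ≤ 1) :
    ∃ t ≤ N, ((3 : ℝ) ^ t)⁻¹ / 4 ≤ ℓ ∧ ℓ ≤ ((3 : ℝ) ^ t)⁻¹ := by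
  classical
  have hex : ∃ t, ((3 : ℝ) ^ t)⁻¹ / 4 ≤ ℓ := ⟨N, h1⟩
  refine ⟨Nat.find hex, Nat.find_min' hex h1, Nat.find_spec hex, ?_⟩
  rcases Nat.eq_zero_or_pos (Nat.find hex) with h0 | h0
  · rw [h0]; simpa using h2
  · have := Nat.find_min hex (Nat.sub_lt h0 one_pos)
    push Not at this
    obtain ⟨s, hs⟩ : ∃ s, Nat.find hex = s + 1 := ⟨Nat.find hex - 1, by omega⟩
    rw [hs] at this ⊢
    simp only [Nat.add_sub_cancel] at this
    rw [pow_succ, mul_inv]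
    have h3 : (0 : ℝ) < ((3 : ℝ) ^ s)⁻¹ := by positivity
    nlinarith

lemma chain_sum {k : ℕ} (hk : 3000 < k) (ch : ℝ × ℝ → Bool) {q : ℝ} (hq : 1 ≤ q)
    (T : Finset (ℝ × ℝ)) (E : ℝ × ℝ → Set ℝ) (y : ℝ) (n : ℕ)
    (hT : ∀ R ∈ T, R.1 < R.2 ∧ 0 ≤ R.1 ∧ R.2 ≤ 1 ∧ y ∈ ivSet R ∧ dl k n / 4 ≤ len R ∧
      E R ⊆ ivSet R ∧ MeasurableSet (E R))
    (hE : (T : Set (ℝ × ℝ)).PairwiseDisjoint E) :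
    ∑ R ∈ T, avg (wgt k ch) R ^ q * (volume.real (E R) / len R) ≤
      16 * (30 : ℝ) ^ q * k * (aa k ^ n) ^ q := by
  classical
  have ha2 := aa_two hk
  have ha3 := aa_three hk
  have ha : 0 ≤ aa k := by linarith
  have hex : ∀ R, ∃ t, R ∈ T → t ≤ k * n ∧ ((3 : ℝ) ^ t)⁻¹ / 4 ≤ len R ∧
      len R ≤ ((3 : ℝ) ^ t)⁻¹ := by
    intro R
    by_cases hR : R ∈ T
    · obtain ⟨h1, h2, h3, h4, h5, _⟩ := hT R hR
      obtain ⟨t, ht⟩ := scale_exists (N := k * n) h5 (by unfold len; linarith)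
      exact ⟨t, fun _ => ht⟩
    · exact ⟨0, fun h => absurd h hR⟩
  choose t ht using hex
  have hmaps : ∀ R ∈ T, t R ∈ Finset.range ((n + 1) * k) := by
    intro R hR
    have := (ht R hR).1
    rw [Finset.mem_range, Nat.succ_mul, mul_comm n]
    omega
  rw [← Finset.sum_fiberwise_of_maps_to hmaps]
  have hfib : ∀ s, ∑ R ∈ T with t R = s, avg (wgt k ch) R ^ q * (volume.real (E R) / len R) ≤
      (10 * aa k ^ (s / k + 1)) ^ q * 8 := by
    intro s
    have hs0 : (0 : ℝ) < 3 ^ s := by positivity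
    have hmem : ∀ R ∈ T.filter (fun R => t R = s), R ∈ T ∧ ((3 : ℝ) ^ s)⁻¹ / 4 ≤ len R ∧
        len R ≤ ((3 : ℝ) ^ s)⁻¹ := by
      intro R hR
      obtain ⟨h1, h2⟩ := Finset.mem_filter.1 hR
      have := (ht R h1).2
      rw [h2] at this
      exact ⟨h1, this⟩
    have hsub : ∀ R ∈ T.filter (fun R => t R = s), E R ⊆
        Set.Icc (y - ((3 : ℝ) ^ s)⁻¹) (y + ((3 : ℝ) ^ s)⁻¹) := by
      intro R hR x hx
      obtain ⟨h1, h2, h3⟩ := hmem R hR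
      obtain ⟨_, _, _, h4, _, h5, _⟩ := hT R h1
      have hx' : R.1 ≤ x ∧ x < R.2 := h5 hx
      have hy' : R.1 ≤ y ∧ y < R.2 := h4
      unfold len at h3
      constructor <;> linarith
    have hvol : ∑ R ∈ T with t R = s, volume.real (E R) ≤ 2 * ((3 : ℝ) ^ s)⁻¹ := by
      have hd := hE.subset (Finset.coe_subset.2 (Finset.filter_subset (fun R => t R = s) T))
      have hm : ∀ R ∈ T.filter (fun R => t R = s), MeasurableSet (E R) :=
        fun R hR => (hT R (hmem R hR).1).2.2.2.2.2.2
      have hfin : ∀ R ∈ T.filter (fun R => t R = s), volume (E R) ≠ ⊤ :=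
        fun R hR => ((measure_mono (hsub R hR)).trans_lt (by simp)).ne
      rw [← measureReal_biUnion_finset hd hm hfin]
      refine (measureReal_mono (Set.iUnion₂_subset hsub) (by simp)).trans ?_
      rw [Real.volume_real_Icc, max_eq_left]
      · linarith
      · have : (0 : ℝ) < ((3 : ℝ) ^ s)⁻¹ := by positivity
        linarith
    calc _ ≤ ∑ R ∈ T with t R = s, (10 * aa k ^ (s / k + 1)) ^ q *
          (volume.real (E R) * (4 * 3 ^ s)) := by
          apply Finset.sum_le_sum
          intro R hR
          obtain ⟨h1, h2, h3⟩ := hmem R hR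
          obtain ⟨h4, h5, _⟩ := hT R h1
          have hlen : 0 < len R := by unfold len; linarith
          have hav : avg (wgt k ch) R ≤ 10 * aa k ^ (s / k + 1) := by
            apply avg_le hk ch h5 h4
            refine le_trans ?_ h2
            unfold dl
            gcongr
            · norm_num
            · have := Nat.lt_mul_div_succ s (show 0 < k by omega)
              exact this.le
          have hav0 := avg_nonneg (wgt_nonneg hk ch) h4
          have : volume.real (E R) / len R ≤ volume.real (E R) * (4 * 3 ^ s) := by
            rw [div_eq_mul_inv]
            gcongr
            rw [inv_le_comm₀ hlen (by positivity)]
            refine le_trans (le_of_eq ?_) h2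
            field_simp
          gcongr
      _ = (10 * aa k ^ (s / k + 1)) ^ q * (4 * 3 ^ s) * ∑ R ∈ T with t R = s, volume.real (E R) := by
          rw [Finset.mul_sum]
          apply Finset.sum_congr rfl
          intro R _; ring
      _ ≤ (10 * aa k ^ (s / k + 1)) ^ q * (4 * 3 ^ s) * (2 * ((3 : ℝ) ^ s)⁻¹) := by gcongr
      _ = _ := by field_simp; ring
  refine (Finset.sum_le_sum fun s _ => hfib s).trans ?_
  rw [sum_div_range (fun i => (10 * aa k ^ (i + 1)) ^ q * 8) k (by omega)]
  have hb : 2 ≤ aa k ^ q := by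
    calc (2 : ℝ) ≤ aa k := ha2
      _ = aa k ^ (1 : ℝ) := (Real.rpow_one _).symm
      _ ≤ aa k ^ q := Real.rpow_le_rpow_of_exponent_le (by linarith) hq
  have hpw : ∀ i : ℕ, (aa k ^ i) ^ q = (aa k ^ q) ^ i := by
    intro i
    rw [← Real.rpow_natCast, ← Real.rpow_natCast, ← Real.rpow_mul ha, ← Real.rpow_mul ha, mul_comm]
  have hterm : ∀ i : ℕ, (10 * aa k ^ (i + 1)) ^ q * 8 ≤ 8 * 30 ^ q * (aa k ^ q) ^ i := by
    intro i
    rw [← hpw]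
    calc (10 * aa k ^ (i + 1)) ^ q * 8 ≤ (30 * aa k ^ i) ^ q * 8 := by
          refine mul_le_mul_of_nonneg_right (Real.rpow_le_rpow (by positivity) ?_ (by linarith))
            (by norm_num)
          rw [pow_succ]
          nlinarith [pow_nonneg ha i]
      _ = _ := by rw [Real.mul_rpow (by norm_num) (by positivity)]; ring
  calc (k : ℝ) * ∑ i ∈ Finset.range (n + 1), (10 * aa k ^ (i + 1)) ^ q * 8
      ≤ k * ∑ i ∈ Finset.range (n + 1), 8 * 30 ^ q * (aa k ^ q) ^ i := by
        exact mul_le_mul_of_nonneg_left (Finset.sum_le_sum fun i _ => hterm i) (by positivity)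
    _ = k * (8 * 30 ^ q * ∑ i ∈ Finset.range (n + 1), (aa k ^ q) ^ i) := by
        rw [Finset.mul_sum (s := Finset.range (n+1)) (a := 8 * (30:ℝ) ^ q)]
    _ ≤ k * (8 * 30 ^ q * (2 * (aa k ^ q) ^ n)) := by gcongr; exact geom_le _ hb n
    _ = _ := by rw [hpw]; ring


/-! ### Powers of the weight -/

def pw (s : ℝ) (k : ℕ) (ch : ℝ × ℝ → Bool) (x : ℝ) : ℝ :=
  if 0 < wgt k ch x then wgt k ch x ^ s else 0

lemma sgm_eq (p : ℝ) (k : ℕ) (ch : ℝ × ℝ → Bool) : sgm p k ch = pw (1 - p) k ch := rfl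

lemma aa_pow_one {k : ℕ} (hk : 3000 < k) (n : ℕ) : 1 ≤ aa k ^ n :=
  one_le_pow₀ (by linarith [aa_two hk])

lemma pw_mem {k : ℕ} (hk : 3000 < k) {ch : ℝ × ℝ → Bool} (s : ℝ) {x : ℝ} {i : ℕ}
    (h : x ∈ UU k ch i) : pw s k ch x = (aa k ^ (i + 1)) ^ s := by
  have := aa_pow_one hk (i + 1)
  unfold pw
  rw [wgt_mem hk h, if_pos (by linarith)]

lemma pw_notMem {k : ℕ} (hk : 3000 < k) {ch : ℝ × ℝ → Bool} (s : ℝ) {x : ℝ}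
    (h : ∀ i, x ∉ UU k ch i) : pw s k ch x = 0 := by
  unfold pw
  rw [wgt_notMem hk h]; simp

lemma pw_nonneg (s : ℝ) (k : ℕ) (ch : ℝ × ℝ → Bool) (x : ℝ) : 0 ≤ pw s k ch x := by
  unfold pw
  split_ifs with h
  · positivity
  · exact le_rfl

lemma pw_le_one {k : ℕ} (hk : 3000 < k) {ch : ℝ × ℝ → Bool} {s : ℝ} (hs : s ≤ 0) (x : ℝ) :
    pw s k ch x ≤ 1 := by
  by_cases h : ∃ i, x ∈ UU k ch i
  · obtain ⟨i, hi⟩ := h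
    rw [pw_mem hk s hi]
    exact Real.rpow_le_one_of_one_le_of_nonpos (aa_pow_one hk _) hs
  · push Not at h
    rw [pw_notMem hk s h]; norm_num

lemma pw_meas {k : ℕ} (hk : 3000 < k) (ch : ℝ × ℝ → Bool) (s : ℝ) : Measurable (pw s k ch) := by
  unfold pw
  have := wgt_meas hk ch
  exact Measurable.ite (measurableSet_lt measurable_const this) (this.pow_const s) measurable_const

lemma pw_int {k : ℕ} (hk : 3000 < k) (ch : ℝ × ℝ → Bool) {s : ℝ} (hs : s ≤ 0) :
    Integrable (pw s k ch) := by
  have h1 : Integrable ((Set.Ico (0 : ℝ) 1).indicator (fun _ => (1 : ℝ))) := by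
    rw [integrable_indicator_iff measurableSet_Ico]
    exact integrableOn_const (by simp)
  refine h1.mono' (pw_meas hk ch s).aestronglyMeasurable (Filter.Eventually.of_forall fun x => ?_)
  rw [Real.norm_of_nonneg (pw_nonneg s k ch x)]
  by_cases h : ∃ i, x ∈ UU k ch i
  · obtain ⟨i, hi⟩ := h
    rw [Set.indicator_of_mem (UU_unit hk hi)]
    exact pw_le_one hk hs x
  · push Not at h
    rw [pw_notMem hk s h]
    exact Set.indicator_nonneg (fun _ _ => zero_le_one) x

/-! ### Large intervals -/

def Big (k : ℕ) (ch : ℝ × ℝ → Bool) (R : ℝ × ℝ) : Prop :=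
  ∀ i, ∀ y ∈ ivSet R, y ∈ UU k ch i → dl k (i + 1) / 4 ≤ len R

lemma big_sum {k : ℕ} (hk : 3000 < k) (ch : ℝ × ℝ → Bool) {q s : ℝ} (hq : 1 ≤ q) (hs : s ≤ 0)
    (g : ℝ → ℝ) (hg0 : ∀ x, 0 ≤ g x) (hgi : Integrable g)
    (hg : ∀ i, ∀ x ∈ UU k ch i, g x = (aa k ^ (i + 1)) ^ q * pw s k ch x)
    {L : ℝ × ℝ} (hL0 : 0 ≤ L.1) (hL1 : L.2 ≤ 1)
    (T : Finset (ℝ × ℝ)) (E : ℝ × ℝ → Set ℝ)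
    (hT : ∀ R ∈ T, R.1 < R.2 ∧ ivSet R ⊆ ivSet L ∧ E R ⊆ ivSet R ∧ MeasurableSet (E R))
    (hE : (T : Set (ℝ × ℝ)).PairwiseDisjoint E) (hb : ∀ R ∈ T, Big k ch R) :
    ∑ R ∈ T, avg (wgt k ch) R ^ q * avg (pw s k ch) R * volume.real (E R) ≤
      16 * (30 : ℝ) ^ q * k * mass g L := by
  classical
  set a : ℝ × ℝ → ℝ := fun R => avg (wgt k ch) R ^ q * (volume.real (E R) / len R) with ha
  have hfi := pw_int hk ch hs
  have hii : ∀ R, Integrable ((ivSet R).indicator (pw s k ch)) :=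
    fun R => hfi.indicator (iv_meas R)
  have hterm : ∀ R ∈ T, avg (wgt k ch) R ^ q * avg (pw s k ch) R * volume.real (E R) =
      ∫ x in ivSet L, a R * (ivSet R).indicator (pw s k ch) x := by
    intro R hR
    rw [integral_const_mul, setIntegral_indicator (iv_meas R),
      Set.inter_eq_self_of_subset_right (hT R hR).2.1]
    simp only [ha, avg, mass]
    ring
  rw [Finset.sum_congr rfl hterm, ← integral_finsetSum _
    fun R _ => ((hii R).const_mul _).integrableOn]
  unfold mass
  rw [← integral_const_mul]
  apply integral_mono
  · exact integrable_finsetSum _ fun R _ => ((hii R).const_mul _).integrableOn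
  · exact (hgi.const_mul _).integrableOn
  intro x
  simp only
  by_cases h : ∃ i, x ∈ UU k ch i
  · obtain ⟨i, hi⟩ := h
    rw [hg i x hi]
    have h1 : ∑ R ∈ T, a R * (ivSet R).indicator (pw s k ch) x =
        (∑ R ∈ T with x ∈ ivSet R, a R) * pw s k ch x := by
      rw [Finset.sum_filter, Finset.sum_mul]
      apply Finset.sum_congr rfl
      intro R _
      by_cases hx : x ∈ ivSet R <;> simp [hx]
    rw [h1, ← mul_assoc]
    apply mul_le_mul_of_nonneg_right _ (pw_nonneg s k ch x)
    apply chain_sum hk ch hq _ E x (i + 1)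
    · intro R hR
      obtain ⟨hR, hx⟩ := Finset.mem_filter.1 hR
      obtain ⟨h1, h2, h3, h4⟩ := hT R hR
      have h5 := iv_sub h1 h2
      exact ⟨h1, hL0.trans h5.1, h5.2.trans hL1, hx, hb R hR i x hx hi, h3, h4⟩
    · exact hE.subset (Finset.coe_subset.2 (Finset.filter_subset _ _))
  · push Not at h
    have h0 := pw_notMem hk s h
    have : ∑ R ∈ T, a R * (ivSet R).indicator (pw s k ch) x = 0 := by
      apply Finset.sum_eq_zero
      intro R _
      by_cases hx : x ∈ ivSet R <;> simp [hx, h0]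
    rw [this]
    have := hg0 x
    positivity

/-! ### Small intervals -/

lemma small_struct {k : ℕ} (hk : 3000 < k) {ch : ℝ × ℝ → Bool} {R : ℝ × ℝ}
    (h : ¬ Big k ch R) : ∃ i m, m ∈ MM k i ∧
      ∀ (u : ℝ → ℝ) (c : ℝ), (∀ x, (∀ j, x ∉ UU k ch j) → u x = 0) →
        (∀ x ∈ UU k ch i, u x = c) →
        avg u R = c * (volume.real (ivSet R ∩ ivSet (cell k (i + 1) (cI k ch i m))) / len R) := by
  unfold Big at h
  push Not at h
  obtain ⟨i, y, hy, hyU, hlen⟩ := h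
  obtain ⟨m, hm, hyc⟩ := mem_UU.1 hyU
  refine ⟨i, m, hm, fun u c hu0 huc => ?_⟩
  have key : ∀ x ∈ ivSet R, u x = (ivSet (cell k (i + 1) (cI k ch i m))).indicator (fun _ => c) x := by
    intro x hx
    by_cases hxc : x ∈ ivSet (cell k (i + 1) (cI k ch i m))
    · rw [Set.indicator_of_mem hxc]
      exact huc x (mem_UU.2 ⟨m, hm, hxc⟩)
    · rw [Set.indicator_of_notMem hxc]
      apply hu0
      intro j hj
      apply hxc
      refine UU_small hk hm hyc (lt_of_le_of_lt ?_ hlen) hj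
      have hx' : R.1 ≤ x ∧ x < R.2 := hx
      have hy' : R.1 ≤ y ∧ y < R.2 := hy
      unfold len
      rw [abs_le]; constructor <;> linarith
  unfold avg mass
  rw [setIntegral_congr_fun (iv_meas R) key, setIntegral_indicator (iv_meas _), setIntegral_const,
    smul_eq_mul]
  ring

lemma small_total {k : ℕ} (hk : 3000 < k) (ch : ℝ × ℝ → Bool) (v : ℝ → ℝ) (hv0 : ∀ x, 0 ≤ v x)
    (hvi : Integrable v) (c : ℕ → ℝ) (hc : ∀ i, 0 ≤ c i) (hv : ∀ i, ∀ x ∈ UU k ch i, v x = c i)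
    (L : ℝ × ℝ) (T : Finset (ℝ × ℝ)) (E : ℝ × ℝ → Set ℝ)
    (hT : ∀ R ∈ T, R.1 < R.2 ∧ ivSet R ⊆ ivSet L ∧ E R ⊆ ivSet R ∧ MeasurableSet (E R))
    (hE : (T : Set (ℝ × ℝ)).PairwiseDisjoint E) (t : ℝ × ℝ → ℝ)
    (idx : ℝ × ℝ → ℕ × ℕ) (hidx : ∀ R ∈ T, (idx R).2 ∈ MM k (idx R).1)
    (ht : ∀ R ∈ T, t R ≤ c (idx R).1 * ((volume.real (ivSet R ∩
      ivSet (cell k ((idx R).1 + 1) (cI k ch (idx R).1 (idx R).2))) / len R) ^ 2 *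
        volume.real (E R))) :
    ∑ R ∈ T, t R ≤ 8 * Real.pi * mass v L := by
  classical
  set Q : ℕ × ℕ → ℝ × ℝ := fun z => cell k (z.1 + 1) (cI k ch z.1 z.2) with hQ
  have hmaps : ∀ R ∈ T, idx R ∈ T.image idx := fun R hR => Finset.mem_image_of_mem _ hR
  have hmem : ∀ z ∈ T.image idx, z.2 ∈ MM k z.1 := by
    intro z hz
    obtain ⟨R, hR, rfl⟩ := Finset.mem_image.1 hz
    exact hidx R hR
  rw [← Finset.sum_fiberwise_of_maps_to hmaps]
  have hdis : ((T.image idx : Finset (ℕ × ℕ)) : Set (ℕ × ℕ)).PairwiseDisjoint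
      (fun z => ivSet L ∩ ivSet (Q z)) := by
    intro z hz z' hz' hne
    rw [Function.onFun, Set.disjoint_left]
    rintro x ⟨_, hx⟩ ⟨_, hx'⟩
    apply hne
    have e1 : z.1 = z'.1 := UU_disj hk (mem_UU.2 ⟨z.2, hmem z hz, hx⟩)
      (mem_UU.2 ⟨z'.2, hmem z' hz', hx'⟩)
    have h1 := UU_cell hk hx
    have h2 := UU_cell hk hx'
    rw [← e1] at h2
    exact Prod.ext e1 (cell_unique h1 h2)
  calc _ ≤ ∑ z ∈ T.image idx, 8 * Real.pi * ∫ x in ivSet L ∩ ivSet (Q z), v x := by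
        apply Finset.sum_le_sum
        intro z hz
        have h1 : ∫ x in ivSet L ∩ ivSet (Q z), v x = volume.real (ivSet L ∩ ivSet (Q z)) * c z.1 := by
          rw [← smul_eq_mul, ← setIntegral_const]
          apply setIntegral_congr_fun ((iv_meas _).inter (iv_meas _))
          intro x hx
          exact hv z.1 x (mem_UU.2 ⟨z.2, hmem z hz, hx.2⟩)
        have h2 := small_sum (T.filter fun R => idx R = z) E L (Q z)
          (fun R hR => hT R (Finset.mem_filter.1 hR).1)
          (hE.subset (Finset.coe_subset.2 (Finset.filter_subset _ _)))
        rw [h1]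
        calc _ ≤ ∑ R ∈ T with idx R = z, c z.1 *
              ((volume.real (ivSet R ∩ ivSet (Q z)) / len R) ^ 2 * volume.real (E R)) := by
              apply Finset.sum_le_sum
              intro R hR
              obtain ⟨hR1, hR2⟩ := Finset.mem_filter.1 hR
              have := ht R hR1
              rw [hR2] at this
              exact this
          _ = c z.1 * ∑ R ∈ T with idx R = z,
              (volume.real (ivSet R ∩ ivSet (Q z)) / len R) ^ 2 * volume.real (E R) := by
              rw [Finset.mul_sum]
          _ ≤ c z.1 * (8 * Real.pi * volume.real (ivSet L ∩ ivSet (Q z))) :=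
              mul_le_mul_of_nonneg_left h2 (hc _)
          _ = _ := by ring
    _ = 8 * Real.pi * ∑ z ∈ T.image idx, ∫ x in ivSet L ∩ ivSet (Q z), v x := by
        rw [Finset.mul_sum]
    _ ≤ _ := by
        apply mul_le_mul_of_nonneg_left _ (by positivity)
        rw [← integral_biUnion_finset _ (fun z _ => (iv_meas _).inter (iv_meas _)) hdis
          fun z _ => hvi.integrableOn]
        exact setIntegral_mono_set hvi.integrableOn (Filter.Eventually.of_forall hv0)
          (Set.iUnion₂_subset fun z _ => Set.inter_subset_left).eventuallyLE

lemma jensen {k : ℕ} (hk : 3000 < k) (ch : ℝ × ℝ → Bool) {p : ℝ} (hp : 1 < p) {R : ℝ × ℝ}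
    (hR : R.1 < R.2) : avg (pw (1 - p) k ch) R ^ (p / (p - 1)) ≤ avg (pw (-p) k ch) R := by
  have hq : 1 ≤ p / (p - 1) := by rw [le_div_iff₀ (by linarith)]; linarith
  have hlen : 0 < len R := by unfold len; linarith
  have hav : ∀ u : ℝ → ℝ, avg u R = ⨍ x in ivSet R, u x := by
    intro u
    rw [setAverage_eq, vol_iv hR, smul_eq_mul]
    unfold avg mass
    ring
  have hpt : ∀ x, pw (1 - p) k ch x ^ (p / (p - 1)) = pw (-p) k ch x := by
    intro x
    unfold pw
    split_ifs with h
    · rw [← Real.rpow_mul h.le]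
      congr 1
      have : p - 1 ≠ 0 := by linarith
      field_simp
      ring
    · exact Real.zero_rpow (by linarith)
  have := (convexOn_rpow hq).map_set_average_le (μ := volume) (t := ivSet R)
    (f := pw (1 - p) k ch)
    (by apply ContinuousOn.rpow_const continuousOn_id; intro x _; right; linarith)
    isClosed_Ici
    (by
      intro h
      have h2 := vol_iv hR
      rw [measureReal_def, h] at h2
      simp at h2
      linarith)
    (iv_ne_top R) (Filter.Eventually.of_forall fun x => pw_nonneg _ k ch x)
    (pw_int hk ch (by linarith)).integrableOn
    (by
      have : (fun x : ℝ => x ^ (p / (p - 1))) ∘ pw (1 - p) k ch = pw (-p) k ch := by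
        ext x; exact hpt x
      rw [this]
      exact (pw_int hk ch (by linarith)).integrableOn)
  simp only [hpt] at this
  rw [hav, hav]
  exact this

lemma theta_le {R : ℝ × ℝ} (hR : R.1 < R.2) (Q : Set ℝ) :
    0 ≤ volume.real (ivSet R ∩ Q) / len R ∧ volume.real (ivSet R ∩ Q) / len R ≤ 1 := by
  have hlen : 0 < len R := by unfold len; linarith
  refine ⟨by positivity, ?_⟩
  rw [div_le_one hlen, ← vol_iv hR]
  exact measureReal_mono Set.inter_subset_left (iv_ne_top R)

lemma rpow_le_self_of {θ q : ℝ} (h0 : 0 ≤ θ) (h1 : θ ≤ 1) (hq : 1 ≤ q) : θ ^ q ≤ θ := by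
  calc θ ^ q ≤ θ ^ (1 : ℝ) := Real.rpow_le_rpow_of_exponent_ge_of_imp h0 h1 hq (fun _ h => by linarith)
    _ = θ := Real.rpow_one θ

lemma small_exists {k : ℕ} (hk : 3000 < k) (ch : ℝ × ℝ → Bool) :
    ∃ idx : ℝ × ℝ → ℕ × ℕ, ∀ R, ¬ Big k ch R → (idx R).2 ∈ MM k (idx R).1 ∧
      ∀ (u : ℝ → ℝ) (c : ℝ), (∀ x, (∀ j, x ∉ UU k ch j) → u x = 0) →
        (∀ x ∈ UU k ch (idx R).1, u x = c) →
        avg u R = c * (volume.real (ivSet R ∩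
          ivSet (cell k ((idx R).1 + 1) (cI k ch (idx R).1 (idx R).2))) / len R) := by
  have : ∀ R, ∃ z : ℕ × ℕ, ¬ Big k ch R → z.2 ∈ MM k z.1 ∧
      ∀ (u : ℝ → ℝ) (c : ℝ), (∀ x, (∀ j, x ∉ UU k ch j) → u x = 0) →
        (∀ x ∈ UU k ch z.1, u x = c) →
        avg u R = c * (volume.real (ivSet R ∩
          ivSet (cell k (z.1 + 1) (cI k ch z.1 z.2))) / len R) := by
    intro R
    by_cases h : Big k ch R
    · exact ⟨(0, 0), fun h' => absurd h h'⟩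
    · obtain ⟨i, m, hm, hh⟩ := small_struct hk h
      exact ⟨(i, m), fun _ => ⟨hm, hh⟩⟩
  choose idx h using this
  exact ⟨idx, h⟩

lemma total_one {k : ℕ} (hk : 3000 < k) (ch : ℝ × ℝ → Bool) {p : ℝ} (hp : 1 < p)
    {L : ℝ × ℝ} (hL0 : 0 ≤ L.1) (hL1 : L.2 ≤ 1)
    (T : Finset (ℝ × ℝ)) (E : ℝ × ℝ → Set ℝ)
    (hT : ∀ R ∈ T, R.1 < R.2 ∧ ivSet R ⊆ ivSet L ∧ E R ⊆ ivSet R ∧ MeasurableSet (E R))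
    (hE : (T : Set (ℝ × ℝ)).PairwiseDisjoint E) :
    ∑ R ∈ T, avg (wgt k ch) R ^ p * avg (sgm p k ch) R * volume.real (E R) ≤
      16 * (30 : ℝ) ^ p * k * mass (wgt k ch) L + 8 * Real.pi * mass (wgt k ch) L := by
  classical
  obtain ⟨idx, hidx⟩ := small_exists hk ch
  rw [sgm_eq, ← Finset.sum_filter_add_sum_filter_not T (fun R => Big k ch R)]
  refine add_le_add ?_ ?_
  · apply big_sum hk ch hp.le (by linarith) _ (wgt_nonneg hk ch) (wgt_int hk ch) _ hL0 hL1
    · exact fun R hR => hT R (Finset.mem_filter.1 hR).1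
    · exact hE.subset (Finset.coe_subset.2 (Finset.filter_subset _ _))
    · exact fun R hR => (Finset.mem_filter.1 hR).2
    · intro i x hx
      have := aa_pow_one hk (i + 1)
      rw [wgt_mem hk hx, pw_mem hk _ hx, ← Real.rpow_add (by linarith)]
      simp
  · apply small_total hk ch _ (wgt_nonneg hk ch) (wgt_int hk ch) (fun i => aa k ^ (i + 1)) _ _ L _ E
      _ _ _ idx
    · exact fun R hR => (hidx R (Finset.mem_filter.1 hR).2).1
    · intro R hR
      obtain ⟨hR1, hR2⟩ := Finset.mem_filter.1 hR
      have h := (hidx R hR2).2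
      set i := (idx R).1
      set m := (idx R).2
      have hA := aa_pow_one hk (i + 1)
      rw [h (wgt k ch) (aa k ^ (i + 1)) (fun x => wgt_notMem hk) (fun x => wgt_mem hk),
        h (pw (1 - p) k ch) ((aa k ^ (i + 1)) ^ (1 - p)) (fun x => pw_notMem hk _)
          (fun x => pw_mem hk _)]
      obtain ⟨h0, h1⟩ := theta_le (hT R hR1).1 (ivSet (cell k (i + 1) (cI k ch i m)))
      set θ := volume.real (ivSet R ∩ ivSet (cell k (i + 1) (cI k ch i m))) / len R
      set A := aa k ^ (i + 1)
      have h2 := rpow_le_self_of h0 h1 hp.le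
      have h3 : A ^ p * A ^ (1 - p) = A := by
        rw [← Real.rpow_add (by linarith)]; simp
      calc (A * θ) ^ p * (A ^ (1 - p) * θ) * volume.real (E R)
          = (A ^ p * A ^ (1 - p)) * (θ ^ p * θ * volume.real (E R)) := by
            rw [Real.mul_rpow (by linarith) h0]; ring
        _ = A * (θ ^ p * θ * volume.real (E R)) := by rw [h3]
        _ ≤ A * (θ * θ * volume.real (E R)) := by gcongr
        _ = _ := by ring
    · exact fun i => by linarith [aa_pow_one hk (i + 1)]
    · exact fun i x hx => wgt_mem hk hx
    · exact fun R hR => hT R (Finset.mem_filter.1 hR).1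
    · exact hE.subset (Finset.coe_subset.2 (Finset.filter_subset _ _))

lemma total_two {k : ℕ} (hk : 3000 < k) (ch : ℝ × ℝ → Bool) {p : ℝ} (hp : 1 < p)
    {L : ℝ × ℝ} (hL0 : 0 ≤ L.1) (hL1 : L.2 ≤ 1)
    (T : Finset (ℝ × ℝ)) (E : ℝ × ℝ → Set ℝ)
    (hT : ∀ R ∈ T, R.1 < R.2 ∧ ivSet R ⊆ ivSet L ∧ E R ⊆ ivSet R ∧ MeasurableSet (E R))
    (hE : (T : Set (ℝ × ℝ)).PairwiseDisjoint E) :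
    ∑ R ∈ T, avg (sgm p k ch) R ^ (p / (p - 1)) * avg (wgt k ch) R * volume.real (E R) ≤
      16 * (30 : ℝ) ^ (1 : ℝ) * k * mass (sgm p k ch) L + 8 * Real.pi * mass (sgm p k ch) L := by
  classical
  have hq : 1 ≤ p / (p - 1) := by rw [le_div_iff₀ (by linarith)]; linarith
  have hpq : (1 - p) * (p / (p - 1)) = -p := by
    have : p - 1 ≠ 0 := by linarith
    field_simp
    ring
  obtain ⟨idx, hidx⟩ := small_exists hk ch
  have hintg := pw_int hk ch (s := 1 - p) (by linarith)
  rw [sgm_eq, ← Finset.sum_filter_add_sum_filter_not T (fun R => Big k ch R)]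
  refine add_le_add ?_ ?_
  · refine le_trans (Finset.sum_le_sum (g := fun R => avg (wgt k ch) R ^ (1 : ℝ) *
      avg (pw (-p) k ch) R * volume.real (E R)) fun R hR => ?_) ?_
    · have hR1 := (hT R (Finset.mem_filter.1 hR).1).1
      have h1 := jensen hk ch hp hR1
      have h2 := avg_nonneg (wgt_nonneg hk ch) hR1
      rw [Real.rpow_one, mul_comm (avg (wgt k ch) R)]
      gcongr
    apply big_sum hk ch le_rfl (by linarith) _ (pw_nonneg (1 - p) k ch) hintg _ hL0 hL1
    · exact fun R hR => hT R (Finset.mem_filter.1 hR).1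
    · exact hE.subset (Finset.coe_subset.2 (Finset.filter_subset _ _))
    · exact fun R hR => (Finset.mem_filter.1 hR).2
    · intro i x hx
      have := aa_pow_one hk (i + 1)
      rw [pw_mem hk _ hx, pw_mem hk _ hx, ← Real.rpow_add (by linarith)]
      congr 1
  · apply small_total hk ch _ (pw_nonneg (1 - p) k ch) hintg (fun i => (aa k ^ (i + 1)) ^ (1 - p))
      _ _ L _ E _ _ _ idx
    · exact fun R hR => (hidx R (Finset.mem_filter.1 hR).2).1
    · intro R hR
      obtain ⟨hR1, hR2⟩ := Finset.mem_filter.1 hR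
      have h := (hidx R hR2).2
      set i := (idx R).1
      set m := (idx R).2
      have hA := aa_pow_one hk (i + 1)
      rw [h (wgt k ch) (aa k ^ (i + 1)) (fun x => wgt_notMem hk) (fun x => wgt_mem hk),
        h (pw (1 - p) k ch) ((aa k ^ (i + 1)) ^ (1 - p)) (fun x => pw_notMem hk _)
          (fun x => pw_mem hk _)]
      obtain ⟨h0, h1⟩ := theta_le (hT R hR1).1 (ivSet (cell k (i + 1) (cI k ch i m)))
      set θ := volume.real (ivSet R ∩ ivSet (cell k (i + 1) (cI k ch i m))) / len R
      set A := aa k ^ (i + 1)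
      have hA0 : 0 < A := by linarith
      have h2 := rpow_le_self_of h0 h1 hq
      have h3 : A ^ (-p) * A = A ^ (1 - p) := by
        calc A ^ (-p) * A = A ^ (-p) * A ^ (1 : ℝ) := by rw [Real.rpow_one]
          _ = A ^ (-p + 1) := (Real.rpow_add hA0 _ _).symm
          _ = _ := by congr 1; ring
      calc (A ^ (1 - p) * θ) ^ (p / (p - 1)) * (A * θ) * volume.real (E R)
          = (A ^ (-p) * A) * (θ ^ (p / (p - 1)) * θ * volume.real (E R)) := by
            rw [Real.mul_rpow (by positivity) h0, ← Real.rpow_mul hA0.le, hpq]; ring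
        _ = A ^ (1 - p) * (θ ^ (p / (p - 1)) * θ * volume.real (E R)) := by rw [h3]
        _ ≤ A ^ (1 - p) * (θ * θ * volume.real (E R)) := by gcongr
        _ = _ := by ring
    · intro i
      have := aa_pow_one hk (i + 1)
      positivity
    · exact fun i x hx => pw_mem hk _ hx
    · exact fun R hR => hT R (Finset.mem_filter.1 hR).1
    · exact hE.subset (Finset.coe_subset.2 (Finset.filter_subset _ _))

/-- Proposition 4.2 of the paper (local testing conditions): for every martingale `ε`-sparse
family `𝒮` of subintervals of `[0,1)` and every subinterval `L` of `[0,1)`, the localized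
testing sums are bounded by `C(p)·k·w_k(L)/(1-ε)` and `C(p)·k·σ_k(L)/(1-ε)`. -/
theorem statement12 (p : ℝ) (hp : 1 < p) :
    ∃ C : ℝ, 0 < C ∧ ∀ k : ℕ, 3000 < k → ∀ ch : ℝ × ℝ → Bool,
      ∀ ε : ℝ, 0 < ε → ε < 1 → ∀ S : Set (ℝ × ℝ), MSparse ε S →
      (∀ I ∈ S, ivSet I ⊆ Set.Ico (0 : ℝ) 1) →
      ∀ L : ℝ × ℝ, 0 ≤ L.1 → L.1 < L.2 → L.2 ≤ 1 →
        sumTest p (wgt k ch) (sgm p k ch) {I | I ∈ S ∧ ivSet I ⊆ ivSet L} ≤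
          C * (k : ℝ) * mass (wgt k ch) L / (1 - ε) ∧
        sumTest (p / (p - 1)) (sgm p k ch) (wgt k ch) {I | I ∈ S ∧ ivSet I ⊆ ivSet L} ≤
          C * (k : ℝ) * mass (sgm p k ch) L / (1 - ε) := by

  refine ⟨16 * (30 : ℝ) ^ p + 16 * 30 + 8 * Real.pi, by positivity, ?_⟩
  intro k hk ch ε hε0 hε1 S hS _ L hL0 hL hL1
  have hk1 : (1 : ℝ) ≤ k := by exact_mod_cast (by omega : 1 ≤ k)
  have hsint : Integrable (sgm p k ch) := pw_int hk ch (s := 1 - p) (by linarith)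
  have hs0 : ∀ x, 0 ≤ sgm p k ch x := pw_nonneg (1 - p) k ch
  have hm1 : 0 ≤ mass (wgt k ch) L := integral_nonneg (wgt_nonneg hk ch)
  have hm2 : 0 ≤ mass (sgm p k ch) L := integral_nonneg hs0
  have h30 : (0 : ℝ) ≤ (30 : ℝ) ^ p := by positivity
  have hpi := Real.pi_pos
  constructor
  · apply reduction (by linarith) (wgt_nonneg hk ch) hs0 (wgt_int hk ch) hsint hε1 hS hL0 hL1
      (by positivity)
    intro T E hT hE
    refine (total_one hk ch hp hL0 hL1 T E hT hE).trans ?_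
    have h1 : 8 * Real.pi * mass (wgt k ch) L ≤ 8 * Real.pi * mass (wgt k ch) L * k :=
      le_mul_of_one_le_right (by positivity) hk1
    have h2 : 0 ≤ 16 * 30 * (k : ℝ) * mass (wgt k ch) L := by positivity
    linarith
  · apply reduction (div_pos (by linarith) (by linarith)) hs0 (wgt_nonneg hk ch) hsint
      (wgt_int hk ch) hε1 hS hL0 hL1 (by positivity)
    intro T E hT hE
    refine (total_two hk ch hp hL0 hL1 T E hT hE).trans ?_
    rw [Real.rpow_one]
    have h1 : 8 * Real.pi * mass (sgm p k ch) L ≤ 8 * Real.pi * mass (sgm p k ch) L * k :=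
      le_mul_of_one_le_right (by positivity) hk1
    have h2 : 0 ≤ 16 * (30 : ℝ) ^ p * (k : ℝ) * mass (sgm p k ch) L := by positivity
    linarith

end RTpaper
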